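/- arXiv:2102.07117 — 2 statements merged into one kernel-verified Lean document; each statement's English description precedes it below -/
import Mathlib

section
/- Let N ≥ 3, let Ω ⊂ ℝ^N be a bounded open set, and let μ : Ω → ℝ satisfy |μ(x)| ≤ σ for all x ∈ Ω, for some σ ∈ (0,1). Let h : Ω → ℝ be continuous with h(x) ≥ 0 for all x and h not identically zero. Suppose u, v : ℝ^N → ℝ are continuous on the closure of Ω, vanish on ∂Ω, are twice continuously differentiable and positive on Ω, and both satisfy the equation −Δw(x) + μ(x)·‖∇w(x)‖²/w(x) = h(x) for every x ∈ Ω. Then u = v on Ω. -/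
open MeasureTheory Filter Set

/-- The Euclidean Laplacian: the sum of the second partial derivatives. -/
noncomputable def lap {N : ℕ} (u : EuclideanSpace ℝ (Fin N) → ℝ)
    (x : EuclideanSpace ℝ (Fin N)) : ℝ :=
  ∑ i : Fin N,
    fderiv ℝ (fun y => fderiv ℝ u y (EuclideanSpace.single i 1)) x (EuclideanSpace.single i 1)

section Calculus

variable {E : Type*} [NormedAddCommGroup E] [NormedSpace ℝ E]

theorem ContDiffAt.differentiableAt_fderiv_apply {f : E → ℝ} {x : E} (hf : ContDiffAt ℝ 2 f x)
    (e : E) : DifferentiableAt ℝ (fun y => fderiv ℝ f y e) x := by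
  have h1 : ContDiffAt ℝ 1 (fderiv ℝ f) x := hf.fderiv_right (by norm_num)
  exact (h1.differentiableAt (by norm_num)).clm_apply (differentiableAt_const e)

theorem ContDiffAt.eventually_differentiableAt {f : E → ℝ} {x : E} (hf : ContDiffAt ℝ 2 f x) :
    ∀ᶠ y in nhds x, DifferentiableAt ℝ f y := by
  filter_upwards [hf.eventually (by simp)] with y hy
  exact hy.differentiableAt (by norm_num)

/-- Second derivative test along a direction. -/
theorem IsLocalMax.fderiv_fderiv_apply_nonpos {f : E → ℝ} {x : E} (hmax : IsLocalMax f x)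
    (hf : ContDiffAt ℝ 2 f x) (e : E) :
    fderiv ℝ (fun y => fderiv ℝ f y e) x e ≤ 0 := by
  by_contra! hpos
  set l : ℝ → E := fun t => x + t • e with hl
  have hl0 : l 0 = x := by simp [hl]
  have hld : ∀ t, HasDerivAt l e t := fun t => by
    simpa [hl] using ((hasDerivAt_id' t).smul_const e).const_add x
  have hlt : Tendsto l (nhds 0) (nhds x) := by
    simpa [hl0] using (hld 0).continuousAt.tendsto
  have hd1 : deriv (fun t => f (l t)) =ᶠ[nhds 0] fun t => fderiv ℝ f (l t) e := by
    filter_upwards [hlt.eventually hf.eventually_differentiableAt] with t ht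
    exact (ht.hasFDerivAt.comp_hasDerivAt t (hld t)).deriv
  have hd2 : deriv (deriv (fun t => f (l t))) 0 = fderiv ℝ (fun y => fderiv ℝ f y e) x e := by
    rw [hd1.deriv_eq]
    have h2 : HasFDerivAt (fun y => fderiv ℝ f y e) (fderiv ℝ (fun y => fderiv ℝ f y e) x) (l 0) := by
      rw [hl0]; exact (hf.differentiableAt_fderiv_apply e).hasFDerivAt
    exact (h2.comp_hasDerivAt 0 (hld 0)).deriv
  have hmax' : IsLocalMax (fun t => f (l t)) 0 := by
    have := hlt.eventually hmax
    simpa only [IsLocalMax, IsMaxFilter, hl0] using this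
  have hmin : IsLocalMin (fun t => f (l t)) 0 := by
    refine isLocalMin_of_deriv_deriv_pos (hd2 ▸ hpos) hmax'.deriv_eq_zero ?_
    exact ContinuousAt.comp (by rw [hl0]; exact hf.continuousAt) (hld 0).continuousAt
  have hconst : (fun t => f (l t)) =ᶠ[nhds 0] fun _ => f (l 0) := by
    filter_upwards [hmax', hmin] with t h1 h2
    exact le_antisymm h1 h2
  have := hconst.deriv.deriv_eq
  rw [hd2] at this
  simp at this
  exact hpos.ne' this

theorem fderiv_rpow_apply {u : E → ℝ} {x : E} (hu : DifferentiableAt ℝ u x) (hx : 0 < u x)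
    (γ : ℝ) (e : E) :
    fderiv ℝ (fun y => u y ^ γ) x e = γ * u x ^ (γ - 1) * fderiv ℝ u x e := by
  rw [(hu.hasFDerivAt.rpow_const (Or.inl hx.ne')).fderiv]
  simp

theorem fderiv_fderiv_rpow_apply {u : E → ℝ} {x : E} (hu : ContDiffAt ℝ 2 u x) (hx : 0 < u x)
    (γ : ℝ) (e : E) :
    fderiv ℝ (fun y => fderiv ℝ (fun y => u y ^ γ) y e) x e =
      γ * u x ^ (γ - 1) * fderiv ℝ (fun y => fderiv ℝ u y e) x e
        + γ * (γ - 1) * u x ^ (γ - 2) * (fderiv ℝ u x e) ^ 2 := by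
  have h1 : (fun y => fderiv ℝ (fun y => u y ^ γ) y e) =ᶠ[nhds x]
      fun y => γ * u y ^ (γ - 1) * fderiv ℝ u y e := by
    filter_upwards [hu.eventually_differentiableAt, hu.continuousAt.eventually (lt_mem_nhds hx)]
      with y hy hy'
    exact fderiv_rpow_apply hy hy' γ e
  have hud : DifferentiableAt ℝ u x := hu.differentiableAt (by norm_num)
  have h2 := ((hud.hasFDerivAt.rpow_const (p := γ - 1) (Or.inl hx.ne')).const_mul γ).fun_mul
    (hu.differentiableAt_fderiv_apply e).hasFDerivAt
  rw [h1.fderiv_eq, h2.fderiv]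
  have : γ - 1 - 1 = γ - 2 := by ring
  simp [this]
  ring

end Calculus

section Laplacian

variable {N : ℕ}

theorem IsLocalMax.lap_nonpos {f : EuclideanSpace ℝ (Fin N) → ℝ} {x : EuclideanSpace ℝ (Fin N)}
    (hmax : IsLocalMax f x) (hf : ContDiffAt ℝ 2 f x) : lap f x ≤ 0 :=
  Finset.sum_nonpos fun _ _ => hmax.fderiv_fderiv_apply_nonpos hf _

theorem lap_add {f g : EuclideanSpace ℝ (Fin N) → ℝ} {x : EuclideanSpace ℝ (Fin N)}
    (hf : ContDiffAt ℝ 2 f x) (hg : ContDiffAt ℝ 2 g x) :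
    lap (fun y => f y + g y) x = lap f x + lap g x := by
  unfold lap
  rw [← Finset.sum_add_distrib]
  refine Finset.sum_congr rfl fun i _ => ?_
  have h1 : (fun y => fderiv ℝ (fun y => f y + g y) y (EuclideanSpace.single i 1)) =ᶠ[nhds x]
      fun y => fderiv ℝ f y (EuclideanSpace.single i 1)
        + fderiv ℝ g y (EuclideanSpace.single i 1) := by
    filter_upwards [hf.eventually_differentiableAt, hg.eventually_differentiableAt] with y h1 h2
    rw [fderiv_fun_add h1 h2]; simp
  rw [h1.fderiv_eq, fderiv_fun_add (hf.differentiableAt_fderiv_apply _)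
    (hg.differentiableAt_fderiv_apply _)]
  simp

theorem lap_const_mul {f : EuclideanSpace ℝ (Fin N) → ℝ} {x : EuclideanSpace ℝ (Fin N)}
    (hf : ContDiffAt ℝ 2 f x) (c : ℝ) :
    lap (fun y => c * f y) x = c * lap f x := by
  unfold lap
  rw [Finset.mul_sum]
  refine Finset.sum_congr rfl fun i _ => ?_
  have h1 : (fun y => fderiv ℝ (fun y => c * f y) y (EuclideanSpace.single i 1)) =ᶠ[nhds x]
      fun y => c * fderiv ℝ f y (EuclideanSpace.single i 1) := by
    filter_upwards [hf.eventually_differentiableAt] with y h1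
    rw [fderiv_const_mul h1]; simp
  rw [h1.fderiv_eq, fderiv_const_mul (hf.differentiableAt_fderiv_apply _)]
  simp

theorem lap_rpow {u : EuclideanSpace ℝ (Fin N) → ℝ} {x : EuclideanSpace ℝ (Fin N)}
    (hu : ContDiffAt ℝ 2 u x) (hx : 0 < u x) (γ : ℝ) :
    lap (fun y => u y ^ γ) x = γ * u x ^ (γ - 1) * lap u x
      + γ * (γ - 1) * u x ^ (γ - 2) * ∑ i, (fderiv ℝ u x (EuclideanSpace.single i 1)) ^ 2 := by
  unfold lap
  rw [Finset.mul_sum, Finset.mul_sum, ← Finset.sum_add_distrib]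
  exact Finset.sum_congr rfl fun i _ => fderiv_fderiv_rpow_apply hu hx γ _

theorem norm_gradient_sq_eq_sum (u : EuclideanSpace ℝ (Fin N) → ℝ)
    (x : EuclideanSpace ℝ (Fin N)) :
    ‖gradient u x‖ ^ 2 = ∑ i, (fderiv ℝ u x (EuclideanSpace.single i 1)) ^ 2 := by
  rw [EuclideanSpace.norm_sq_eq]
  refine Finset.sum_congr rfl fun i _ => ?_
  have : fderiv ℝ u x (EuclideanSpace.single i 1)
      = inner ℝ (gradient u x) (EuclideanSpace.single i 1) := by
    simp [gradient]
  rw [this, EuclideanSpace.inner_single_right]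
  simp

theorem fderiv_exp_coord_apply (α : ℝ) (j : Fin N) (x e : EuclideanSpace ℝ (Fin N)) :
    fderiv ℝ (fun y : EuclideanSpace ℝ (Fin N) => Real.exp (α * y j)) x e
      = α * e j * Real.exp (α * x j) := by
  have h1 : HasFDerivAt (fun y : EuclideanSpace ℝ (Fin N) => y j)
      (EuclideanSpace.proj j : EuclideanSpace ℝ (Fin N) →L[ℝ] ℝ) x :=
    (EuclideanSpace.proj j : EuclideanSpace ℝ (Fin N) →L[ℝ] ℝ).hasFDerivAt
  rw [((h1.const_mul α).exp).fderiv]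
  simp
  ring

theorem lap_exp_coord (α : ℝ) (j : Fin N) (x : EuclideanSpace ℝ (Fin N)) :
    lap (fun y : EuclideanSpace ℝ (Fin N) => Real.exp (α * y j)) x
      = α ^ 2 * Real.exp (α * x j) := by
  unfold lap
  rw [Finset.sum_eq_single j]
  · simp_rw [fderiv_exp_coord_apply]
    rw [fderiv_const_mul, _root_.smul_apply, fderiv_exp_coord_apply]
    · simp; ring
    · fun_prop
  · intro i _ hij
    simp_rw [fderiv_exp_coord_apply]
    simp [hij.symm]
  · simp

/-- The substitution `z = u ^ (1 - σ)` turns the equation into one which is monotone in `z`. -/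
theorem lap_rpow_of_equation {u : EuclideanSpace ℝ (Fin N) → ℝ} {x : EuclideanSpace ℝ (Fin N)}
    (hu : ContDiffAt ℝ 2 u x) (hx : 0 < u x) {σ m H : ℝ} (hσ : σ < 1)
    (heq : -lap u x + m * ‖gradient u x‖ ^ 2 / u x = H) :
    lap (fun y => u y ^ (1 - σ)) x =
      (m - σ) / (1 - σ) * ((∑ i, (fderiv ℝ (fun y => u y ^ (1 - σ)) x
        (EuclideanSpace.single i 1)) ^ 2) / u x ^ (1 - σ)) - (1 - σ) * (H * u x ^ (-σ)) := by
  have hγ : 1 - σ ≠ 0 := by linarith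
  have hud : DifferentiableAt ℝ u x := hu.differentiableAt (by norm_num)
  simp_rw [lap_rpow hu hx, fderiv_rpow_apply hud hx, mul_pow, ← Finset.mul_sum]
  rw [norm_gradient_sq_eq_sum] at heq
  set S := ∑ i, (fderiv ℝ u x (EuclideanSpace.single i 1)) ^ 2
  have hL : lap u x = m * S / u x - H := by linarith
  have e1 : u x ^ (1 - σ - 1) = u x ^ (-σ) := by congr 1; ring
  have e2 : u x ^ (1 - σ - 2) = u x ^ (-σ) / u x := by
    rw [show 1 - σ - 2 = -σ - 1 by ring, Real.rpow_sub_one hx.ne']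
  have e3 : u x ^ (1 - σ) = u x ^ (-σ) * u x := by
    rw [show 1 - σ = -σ + 1 by ring, Real.rpow_add_one hx.ne']
  have hp : u x ^ (-σ) ≠ 0 := (Real.rpow_pos_of_pos hx _).ne'
  rw [e1, e2, e3, hL]
  have hx' := hx.ne'
  field_simp
  ring

/-- Comparison principle for two positive solutions with zero boundary data. -/
theorem le_of_singular_gradient_equation
    (j : Fin N) {Ω : Set (EuclideanSpace ℝ (Fin N))}
    (hΩo : IsOpen Ω) (hΩb : Bornology.IsBounded Ω)
    {σ : ℝ} (hσ : σ ∈ Set.Ioo (0 : ℝ) 1)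
    {μ : EuclideanSpace ℝ (Fin N) → ℝ} (hμ : ∀ x ∈ Ω, |μ x| ≤ σ)
    {h : EuclideanSpace ℝ (Fin N) → ℝ} (hh_nonneg : ∀ x ∈ Ω, 0 ≤ h x)
    {u v : EuclideanSpace ℝ (Fin N) → ℝ}
    (hu_cont : ContinuousOn u (closure Ω)) (hu_bdry : ∀ x ∈ frontier Ω, u x = 0)
    (hu : ContDiffOn ℝ 2 u Ω) (hupos : ∀ x ∈ Ω, 0 < u x)
    (hv_cont : ContinuousOn v (closure Ω)) (hv_bdry : ∀ x ∈ frontier Ω, v x = 0)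
    (hv : ContDiffOn ℝ 2 v Ω) (hvpos : ∀ x ∈ Ω, 0 < v x)
    (hueq : ∀ x ∈ Ω, -lap u x + μ x * ‖gradient u x‖ ^ 2 / u x = h x)
    (hveq : ∀ x ∈ Ω, -lap v x + μ x * ‖gradient v x‖ ^ 2 / v x = h x) :
    ∀ x ∈ Ω, u x ≤ v x := by
  obtain ⟨hσ0, hσ1⟩ := hσ
  have hγ : 0 < 1 - σ := by linarith
  by_contra! hcon
  obtain ⟨x₁, hx₁, hlt⟩ := hcon
  set z : EuclideanSpace ℝ (Fin N) → ℝ := fun y => u y ^ (1 - σ) with hz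
  set w : EuclideanSpace ℝ (Fin N) → ℝ := fun y => v y ^ (1 - σ) with hw
  have huat : ∀ x ∈ Ω, ContDiffAt ℝ 2 u x := fun x hx => hu.contDiffAt (hΩo.mem_nhds hx)
  have hvat : ∀ x ∈ Ω, ContDiffAt ℝ 2 v x := fun x hx => hv.contDiffAt (hΩo.mem_nhds hx)
  have hzat : ∀ x ∈ Ω, ContDiffAt ℝ 2 z x := fun x hx =>
    (huat x hx).rpow_const_of_ne (hupos x hx).ne'
  have hwat : ∀ x ∈ Ω, ContDiffAt ℝ 2 w x := fun x hx =>
    (hvat x hx).rpow_const_of_ne (hvpos x hx).ne'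
  have hzpos : ∀ x ∈ Ω, 0 < z x := fun x hx => Real.rpow_pos_of_pos (hupos x hx) _
  have hwpos : ∀ x ∈ Ω, 0 < w x := fun x hx => Real.rpow_pos_of_pos (hvpos x hx) _
  have hdcont : ContinuousOn (fun y => z y - w y) (closure Ω) :=
    (hu_cont.rpow_const fun _ _ => Or.inr hγ.le).sub
      (hv_cont.rpow_const fun _ _ => Or.inr hγ.le)
  have hM : 0 < z x₁ - w x₁ :=
    sub_pos.2 (Real.rpow_lt_rpow (hvpos x₁ hx₁).le hlt hγ)
  set δ := (z x₁ - w x₁) / 2 with hδ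
  have hδ0 : 0 < δ := by positivity
  set K := closure Ω ∩ (fun y => z y - w y) ⁻¹' Ici δ with hK
  have hKc : IsCompact K :=
    hΩb.isCompact_closure.of_isClosed_subset
      (hdcont.preimage_isClosed_of_isClosed isClosed_closure isClosed_Ici) inter_subset_left
  have hKΩ : K ⊆ Ω := by
    rintro x ⟨hxc, hxd⟩
    by_contra hxΩ
    have hxf : x ∈ frontier Ω := by rw [hΩo.frontier_eq]; exact ⟨hxc, hxΩ⟩
    have : z x - w x = 0 := by simp [hz, hw, hu_bdry x hxf, hv_bdry x hxf]
    have hxd' : δ ≤ z x - w x := hxd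
    linarith
  have hx₁K : x₁ ∈ K := ⟨subset_closure hx₁, by simp only [mem_preimage, mem_Ici]; linarith⟩
  have hbcont : ContinuousOn (fun x => (fderiv ℝ z x (EuclideanSpace.single j 1)
      + fderiv ℝ w x (EuclideanSpace.single j 1)) / z x) K := fun x hx =>
    ((((hzat x (hKΩ hx)).differentiableAt_fderiv_apply _).continuousAt.add
      ((hwat x (hKΩ hx)).differentiableAt_fderiv_apply _).continuousAt).div
      (hzat x (hKΩ hx)).continuousAt (hzpos x (hKΩ hx)).ne').continuousWithinAt
  obtain ⟨B, hB⟩ := hKc.exists_bound_of_continuousOn hbcont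
  have hB0 : 0 ≤ B := (norm_nonneg _).trans (hB x₁ hx₁K)
  set c := 2 * σ / (1 - σ) with hc
  have hc0 : 0 ≤ c := by positivity
  set α := c * B + 1 with hα
  have hα0 : 0 < α := by positivity
  set ψ : EuclideanSpace ℝ (Fin N) → ℝ := fun y => Real.exp (α * y j) with hψ
  have hψs : ContDiff ℝ 2 ψ := by
    have : ContDiff ℝ 2 (fun y : EuclideanSpace ℝ (Fin N) => y j) :=
      (EuclideanSpace.proj j : EuclideanSpace ℝ (Fin N) →L[ℝ] ℝ).contDiff
    exact (contDiff_const.mul this).exp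
  have hψpos : ∀ x, 0 < ψ x := fun x => Real.exp_pos _
  obtain ⟨A, hA⟩ := hKc.exists_bound_of_continuousOn hψs.continuous.continuousOn
  have hA0 : 0 ≤ A := (norm_nonneg _).trans (hA x₁ hx₁K)
  set ε := δ / (A + 1) with hε
  have hε0 : 0 < ε := by positivity
  have hεA : ε * A < δ := by
    rw [hε, div_mul_eq_mul_div, div_lt_iff₀ (by positivity)]
    nlinarith
  set W : EuclideanSpace ℝ (Fin N) → ℝ := fun y => (z y + (-1) * w y) + ε * ψ y with hW
  have hWcont : ContinuousOn W K := fun x hx =>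
    (((hzat x (hKΩ hx)).continuousAt.add ((hwat x (hKΩ hx)).continuousAt.const_mul (-1))).add
      (hψs.continuous.continuousAt.const_mul ε)).continuousWithinAt
  obtain ⟨x, hxK, hxmax⟩ := hKc.exists_isMaxOn ⟨x₁, hx₁K⟩ hWcont
  have hxΩ := hKΩ hxK
  have hxδ : δ < z x - w x := by
    have h1 : W x₁ ≤ W x := hxmax hx₁K
    have h2 : ψ x ≤ A := (le_abs_self _).trans (hA x hxK)
    have h3 := mul_le_mul_of_nonneg_left h2 hε0.le
    have h4 := mul_pos hε0 (hψpos x₁)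
    simp only [hW] at h1
    linarith
  have hloc : IsLocalMax W x := by
    have hcx : ContinuousAt (fun y => z y - w y) x :=
      (hzat x hxΩ).continuousAt.sub (hwat x hxΩ).continuousAt
    filter_upwards [hΩo.mem_nhds hxΩ, hcx.eventually (lt_mem_nhds hxδ)] with y hy hy'
    exact hxmax ⟨subset_closure hy, hy'.le⟩
  have hw1 : ContDiffAt ℝ 2 (fun y => (-1) * w y) x := contDiffAt_const.mul (hwat x hxΩ)
  have hψ1 : ContDiffAt ℝ 2 (fun y => ε * ψ y) x := contDiffAt_const.mul hψs.contDiffAt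
  have hzw : ContDiffAt ℝ 2 (fun y => z y + (-1) * w y) x := (hzat x hxΩ).add hw1
  have hlapW := hloc.lap_nonpos (hzw.add hψ1)
  rw [hW, lap_add hzw hψ1, lap_add (hzat x hxΩ) hw1, lap_const_mul (hwat x hxΩ),
    lap_const_mul hψs.contDiffAt, hψ, lap_exp_coord] at hlapW
  have hgrad : ∀ i, fderiv ℝ z x (EuclideanSpace.single i 1)
      = fderiv ℝ w x (EuclideanSpace.single i 1)
        - ε * (α * (EuclideanSpace.single i (1 : ℝ) : EuclideanSpace ℝ (Fin N)) j * ψ x) := by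
    intro i
    have h0 := hloc.fderiv_eq_zero
    rw [hW, fderiv_fun_add (hzw.differentiableAt (by norm_num)) (hψ1.differentiableAt (by norm_num)),
      fderiv_fun_add ((hzat x hxΩ).differentiableAt (by norm_num))
        (hw1.differentiableAt (by norm_num)),
      fderiv_const_mul ((hwat x hxΩ).differentiableAt (by norm_num)),
      fderiv_const_mul (hψs.contDiffAt.differentiableAt (by norm_num))] at h0
    have h1 := congrArg (fun L : EuclideanSpace ℝ (Fin N) →L[ℝ] ℝ =>
      L (EuclideanSpace.single i 1)) h0
    simp only [_root_.add_apply, _root_.smul_apply, smul_eq_mul,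
      _root_.zero_apply, hψ, fderiv_exp_coord_apply] at h1
    linarith
  have hlz := lap_rpow_of_equation (huat x hxΩ) (hupos x hxΩ) hσ1 (hueq x hxΩ)
  have hlw := lap_rpow_of_equation (hvat x hxΩ) (hvpos x hxΩ) hσ1 (hveq x hxΩ)
  change lap z x = (μ x - σ) / (1 - σ) * ((∑ i, (fderiv ℝ z x
        (EuclideanSpace.single i 1)) ^ 2) / z x) - _ at hlz
  change lap w x = (μ x - σ) / (1 - σ) * ((∑ i, (fderiv ℝ w x
        (EuclideanSpace.single i 1)) ^ 2) / w x) - _ at hlw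
  have hsum : (∑ i, (fderiv ℝ z x (EuclideanSpace.single i 1)) ^ 2)
      - (∑ i, (fderiv ℝ w x (EuclideanSpace.single i 1)) ^ 2)
      = -(fderiv ℝ z x (EuclideanSpace.single j 1) + fderiv ℝ w x (EuclideanSpace.single j 1))
        * (ε * (α * ψ x)) := by
    rw [← Finset.sum_sub_distrib, Finset.sum_eq_single j]
    · have := hgrad j
      simp only [PiLp.single_apply, if_true, mul_one] at this
      linear_combination (fderiv ℝ z x (EuclideanSpace.single j 1)
        + fderiv ℝ w x (EuclideanSpace.single j 1)) * this
    · intro i _ hij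
      have := hgrad i
      simp only [PiLp.single_apply, if_neg hij.symm, mul_zero, zero_mul, sub_zero] at this
      rw [this, sub_self]
    · simp
  have hS2 : 0 ≤ ∑ i, (fderiv ℝ w x (EuclideanSpace.single i 1)) ^ 2 :=
    Finset.sum_nonneg fun _ _ => sq_nonneg _
  set S₁ := ∑ i, (fderiv ℝ z x (EuclideanSpace.single i 1)) ^ 2
  set S₂ := ∑ i, (fderiv ℝ w x (EuclideanSpace.single i 1)) ^ 2
  have hη : 0 < ε * (α * ψ x) := mul_pos hε0 (mul_pos hα0 (hψpos x))
  have hT : S₁ / z x - S₂ / w x ≤ B * (ε * (α * ψ x)) := by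
    have h1 : S₂ / z x ≤ S₂ / w x :=
      div_le_div_of_nonneg_left hS2 (hwpos x hxΩ) (by linarith)
    have h2 : S₁ / z x - S₂ / z x = -((fderiv ℝ z x (EuclideanSpace.single j 1)
      + fderiv ℝ w x (EuclideanSpace.single j 1)) / z x) * (ε * (α * ψ x)) := by
      rw [← sub_div, hsum]; ring
    have h3 := mul_le_mul_of_nonneg_right ((neg_le_abs _).trans (hB x hxK)) hη.le
    linarith
  have hk := abs_le.1 (hμ x hxΩ)
  have hk0 : (μ x - σ) / (1 - σ) ≤ 0 := div_nonpos_of_nonpos_of_nonneg (by linarith) hγ.le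
  have hk1 : -c ≤ (μ x - σ) / (1 - σ) := by
    rw [hc, ← neg_div]; exact div_le_div_of_nonneg_right (by linarith) hγ.le
  have h1 := mul_le_mul_of_nonpos_left hT hk0
  have h2 := mul_le_mul_of_nonneg_right hk1 (mul_nonneg hB0 hη.le)
  have huv : v x ≤ u x :=
    ((Real.rpow_lt_rpow_iff (hvpos x hxΩ).le (hupos x hxΩ).le hγ).1
      (show w x < z x by linarith)).le
  have h3 : u x ^ (-σ) ≤ v x ^ (-σ) :=
    Real.rpow_le_rpow_of_nonpos (hvpos x hxΩ) huv (by linarith)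
  have h4 := mul_le_mul_of_nonneg_left
    (mul_le_mul_of_nonneg_left h3 (hh_nonneg x hxΩ)) hγ.le
  have h5 : ε * (α ^ 2 * ψ x) = (c * B + 1) * (ε * (α * ψ x)) := by rw [← hα]; ring
  change lap z x + -1 * lap w x + ε * (α ^ 2 * ψ x) ≤ 0 at hlapW
  rw [h5] at hlapW
  linarith

end Laplacian

theorem uniqueness_model_problem
    {N : ℕ} (hN : 3 ≤ N)
    {Ω : Set (EuclideanSpace ℝ (Fin N))}
    (hΩo : IsOpen Ω) (hΩb : Bornology.IsBounded Ω)
    {σ : ℝ} (hσ : σ ∈ Set.Ioo (0:ℝ) 1)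
    (μ : EuclideanSpace ℝ (Fin N) → ℝ) (hμ : ∀ x ∈ Ω, |μ x| ≤ σ)
    (h : EuclideanSpace ℝ (Fin N) → ℝ)
    (hh_cont : ContinuousOn h Ω) (hh_nonneg : ∀ x ∈ Ω, 0 ≤ h x)
    (hh_ne : ∃ x ∈ Ω, h x ≠ 0)
    (u v : EuclideanSpace ℝ (Fin N) → ℝ)
    (hu_cont : ContinuousOn u (closure Ω)) (hu_bdry : ∀ x ∈ frontier Ω, u x = 0)
    (hu : ContDiffOn ℝ 2 u Ω) (hupos : ∀ x ∈ Ω, 0 < u x)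
    (hv_cont : ContinuousOn v (closure Ω)) (hv_bdry : ∀ x ∈ frontier Ω, v x = 0)
    (hv : ContDiffOn ℝ 2 v Ω) (hvpos : ∀ x ∈ Ω, 0 < v x)
    (hueq : ∀ x ∈ Ω, -lap u x + μ x * ‖gradient u x‖ ^ 2 / u x = h x)
    (hveq : ∀ x ∈ Ω, -lap v x + μ x * ‖gradient v x‖ ^ 2 / v x = h x) :
    Set.EqOn u v Ω := by
  have j : Fin N := ⟨0, by omega⟩
  intro x hx
  exact le_antisymm
    (le_of_singular_gradient_equation j hΩo hΩb hσ hμ hh_nonneg hu_cont hu_bdry hu hupos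
      hv_cont hv_bdry hv hvpos hueq hveq x hx)
    (le_of_singular_gradient_equation j hΩo hΩb hσ hμ hh_nonneg hv_cont hv_bdry hv hvpos
      hu_cont hu_bdry hu hupos hveq hueq x hx)
end

section
/- Let N ≥ 3, p > 1 and σ ∈ (0,1). Let h : (0,∞) → ℝ be continuous with 0 ≤ h(s) and s·h(s) ≤ σ for all s > 0. Let α > 0 and define ψ : [0,∞) → [0,∞) by ψ(s) = ∫₀^s exp(−∫_α^t h(r) dr) dt. Assume that the function s ↦ ψ'(s)·s^p / ψ(s)^{2*−1} is strictly decreasing on (0,∞), where 2* = 2N/(N−2). Then there is no twice continuously differentiable function u : ℝ^N → ℝ with u(x) > 0 for all x and −Δu(x) + h(u(x))·‖∇u(x)‖² = u(x)^p for every x ∈ ℝ^N. -/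
open MeasureTheory Filter Set

/-- ψ(s) = ∫₀ˢ exp(−∫_α^t h(r) dr) dt. -/
noncomputable def psi (h : ℝ → ℝ) (α s : ℝ) : ℝ :=
  ∫ t in (0:ℝ)..s, Real.exp (-∫ r in α..t, h r)

/-- ψ'(s) = exp(−∫_α^s h(r) dr). -/
noncomputable def psi' (h : ℝ → ℝ) (α s : ℝ) : ℝ :=
  Real.exp (-∫ r in α..s, h r)

/-- The critical Sobolev exponent 2* = 2N/(N−2). -/
noncomputable def twoStar (N : ℕ) : ℝ := 2 * N / ((N : ℝ) - 2)

open scoped Topology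

theorem deriv_deriv_nonneg_of_isLocalMin {f d : ℝ → ℝ} {L a : ℝ} (hmin : IsLocalMin f a)
    (hf : ∀ᶠ t in 𝓝 a, HasDerivAt f (d t) t) (hd : HasDerivAt d L a) : 0 ≤ L := by
  by_contra hL
  push Not at hL
  have e1 : deriv f =ᶠ[𝓝 a] d := hf.mono fun t ht => ht.deriv
  have e2 : deriv (deriv f) a = L := by rw [e1.deriv_eq, hd.deriv]
  have hmax : IsLocalMax f a := isLocalMax_of_deriv_deriv_neg (by rw [e2]; exact hL)
    hmin.deriv_eq_zero hf.self_of_nhds.continuousAt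
  have hc : f =ᶠ[𝓝 a] fun _ => f a := by
    filter_upwards [hmin, hmax] with t h1 h2 using le_antisymm h2 h1
  have : deriv (deriv f) a = 0 := by
    rw [hc.deriv.deriv_eq]; simp
  linarith

section lap
variable {N : ℕ}

local notation "𝔼" => EuclideanSpace ℝ (Fin N)

theorem eventually_hasDerivAt_line {w : 𝔼 → ℝ} {y : 𝔼} (hw : ContDiffAt ℝ 2 w y) (e : 𝔼) :
    ∀ᶠ t in 𝓝 (0:ℝ), HasDerivAt (fun t : ℝ => w (y + t • e)) (fderiv ℝ w (y + t • e) e) t := by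
  have h1 : ∀ᶠ z in 𝓝 y, DifferentiableAt ℝ w z := by
    have := hw.eventually (by simp)
    exact this.mono fun z hz => hz.differentiableAt (by norm_num)
  have h2 : Tendsto (fun t : ℝ => y + t • e) (𝓝 0) (𝓝 y) := by
    have : Continuous (fun t : ℝ => y + t • e) := by fun_prop
    simpa using this.tendsto 0
  filter_upwards [h2.eventually h1] with t ht
  have h3 : HasDerivAt (fun t : ℝ => y + t • e) e t := by
    simpa using ((hasDerivAt_id t).smul_const e).const_add y
  exact ht.hasFDerivAt.comp_hasDerivAt t h3

theorem hasDerivAt_fderiv_line {w : 𝔼 → ℝ} {y : 𝔼} (hw : ContDiffAt ℝ 2 w y) (e : 𝔼) :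
    HasDerivAt (fun t : ℝ => fderiv ℝ w (y + t • e) e)
      (fderiv ℝ (fun z => fderiv ℝ w z e) y e) 0 := by
  have h1 : DifferentiableAt ℝ (fun z => fderiv ℝ w z e) y := by
    have : DifferentiableAt ℝ (fderiv ℝ w) y :=
      (hw.fderiv_right (m := 1) (by norm_num)).differentiableAt (by norm_num)
    exact this.clm_apply (differentiableAt_const _)
  have h3 : HasDerivAt (fun t : ℝ => y + t • e) e 0 := by
    simpa using ((hasDerivAt_id (0:ℝ)).smul_const e).const_add y
  have h4 : HasFDerivAt (fun z => fderiv ℝ w z e) (fderiv ℝ (fun z => fderiv ℝ w z e) y)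
      (y + (0:ℝ) • e) := by simpa using h1.hasFDerivAt
  exact h4.comp_hasDerivAt 0 h3

theorem fderiv_fderiv_eq_of_line {w : 𝔼 → ℝ} {y : 𝔼} (hw : ContDiffAt ℝ 2 w y) (e : 𝔼)
    {d : ℝ → ℝ} {L : ℝ} (h1 : ∀ᶠ t in 𝓝 (0:ℝ), HasDerivAt (fun t : ℝ => w (y + t • e)) (d t) t)
    (h2 : HasDerivAt d L 0) : fderiv ℝ (fun z => fderiv ℝ w z e) y e = L := by
  have h3 : d =ᶠ[𝓝 0] fun t : ℝ => fderiv ℝ w (y + t • e) e := by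
    filter_upwards [h1, eventually_hasDerivAt_line hw e] with t a b using a.unique b
  exact ((hasDerivAt_fderiv_line hw e).congr_of_eventuallyEq h3).unique h2

theorem lap_nonneg_of_isLocalMin {w : 𝔼 → ℝ} {y : 𝔼} (hw : ContDiffAt ℝ 2 w y)
    (hmin : IsLocalMin w y) : 0 ≤ lap w y := by
  refine Finset.sum_nonneg fun i _ => ?_
  set e : 𝔼 := EuclideanSpace.single i 1
  refine deriv_deriv_nonneg_of_isLocalMin (a := 0) ?_ (eventually_hasDerivAt_line hw e)
    (hasDerivAt_fderiv_line hw e)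
  have h2 : Tendsto (fun t : ℝ => y + t • e) (𝓝 0) (𝓝 y) := by
    have : Continuous (fun t : ℝ => y + t • e) := by fun_prop
    simpa using this.tendsto 0
  have := h2.eventually hmin
  simpa [IsLocalMin, IsMinFilter] using this

theorem lap_sub {w₁ w₂ : 𝔼 → ℝ} {y : 𝔼} (h₁ : ContDiffAt ℝ 2 w₁ y) (h₂ : ContDiffAt ℝ 2 w₂ y) :
    lap (fun z => w₁ z - w₂ z) y = lap w₁ y - lap w₂ y := by
  unfold lap
  rw [← Finset.sum_sub_distrib]
  refine Finset.sum_congr rfl fun i _ => ?_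
  refine fderiv_fderiv_eq_of_line (h₁.sub h₂) _ ?_
    ((hasDerivAt_fderiv_line h₁ _).sub (hasDerivAt_fderiv_line h₂ _))
  filter_upwards [eventually_hasDerivAt_line h₁ _, eventually_hasDerivAt_line h₂ _] with t a b
    using a.sub b

theorem lap_const_mul_add {w : 𝔼 → ℝ} {y : 𝔼} (hw : ContDiffAt ℝ 2 w y) (c d : ℝ) :
    lap (fun z => c * w z + d) y = c * lap w y := by
  unfold lap
  rw [Finset.mul_sum]
  refine Finset.sum_congr rfl fun i _ => ?_
  refine fderiv_fderiv_eq_of_line ((contDiffAt_const.mul hw).add contDiffAt_const) _ ?_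
    ((hasDerivAt_fderiv_line hw _).const_mul c)
  filter_upwards [eventually_hasDerivAt_line hw _] with t a using (a.const_mul c).add_const d

theorem lap_comp_const_add (w : 𝔼 → ℝ) (x y : 𝔼) :
    lap (fun z => w (x + z)) y = lap w (x + y) := by
  unfold lap
  refine Finset.sum_congr rfl fun i _ => ?_
  simp only [fderiv_comp_add_left]
  rw [fderiv_comp_add_left (f := fun z => fderiv ℝ w z (EuclideanSpace.single i 1))]

theorem lap_eq_sum_fderiv {w : 𝔼 → ℝ} {y : 𝔼} (hw : ContDiffAt ℝ 2 w y) :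
    lap w y = ∑ i : Fin N, fderiv ℝ (fderiv ℝ w) y (EuclideanSpace.single i 1)
      (EuclideanSpace.single i 1) := by
  unfold lap
  refine Finset.sum_congr rfl fun i _ => ?_
  have : DifferentiableAt ℝ (fderiv ℝ w) y :=
      (hw.fderiv_right (m := 1) (by norm_num)).differentiableAt (by norm_num)
  rw [fderiv_clm_apply this (differentiableAt_const _)]
  simp
end lap

section kelvin
variable {N : ℕ}

local notation "𝔼" => EuclideanSpace ℝ (Fin N)

/-- The Kelvin transform `‖z‖⁻ᵏ g (c z / ‖z‖²)` with weight `k`. -/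
noncomputable def kelvin (k : ℕ) (c : ℝ) (g : 𝔼 → ℝ) (z : 𝔼) : ℝ :=
  (‖z‖ ^ k)⁻¹ * g ((c / ‖z‖ ^ 2) • z)

theorem contDiffAt_kelvin (k : ℕ) (c : ℝ) {g : 𝔼 → ℝ} (hg : ContDiff ℝ 2 g) {y : 𝔼} (hy : y ≠ 0) :
    ContDiffAt ℝ 2 (kelvin k c g) y := by
  have hn : ContDiffAt ℝ 2 (fun z : 𝔼 => ‖z‖) y := contDiffAt_norm ℝ hy
  have h0 : ‖y‖ ≠ 0 := norm_ne_zero_iff.2 hy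
  refine ((hn.pow k).inv (pow_ne_zero _ h0)).mul ?_
  refine hg.contDiffAt.comp y ?_
  exact (contDiffAt_const.div (hn.pow 2) (pow_ne_zero _ h0)).smul contDiffAt_id

theorem inv_norm_pow_eq_rpow (k : ℕ) (z : 𝔼) : (‖z‖ ^ k)⁻¹ = (‖z‖ ^ 2) ^ (-((k : ℝ) / 2)) := by
  rw [← Real.rpow_natCast ‖z‖ 2, ← Real.rpow_mul (norm_nonneg z),
    show ((2:ℕ):ℝ) * (-((k : ℝ) / 2)) = -(k:ℝ) by push_cast; ring,
    Real.rpow_neg (norm_nonneg z), Real.rpow_natCast]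

theorem hasDerivAt_kelvin_line (k : ℕ) (c : ℝ) {g : 𝔼 → ℝ} (hg : ContDiff ℝ 2 g) (y e : 𝔼) {t : ℝ}
    (h0 : ‖y + t • e‖ ^ 2 ≠ 0) :
    HasDerivAt (fun t : ℝ => kelvin k c g (y + t • e))
      ((2 * inner ℝ (y + t • e) e) * (-((k:ℝ)/2)) * (‖y + t • e‖ ^ 2) ^ (-((k:ℝ)/2) - 1)
          * g ((c / ‖y + t • e‖ ^ 2) • (y + t • e))
        + (‖y + t • e‖ ^ 2) ^ (-((k:ℝ)/2)) * fderiv ℝ g ((c / ‖y + t • e‖ ^ 2) • (y + t • e))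
          ((c / ‖y + t • e‖ ^ 2) • e
            + (-(c * (2 * inner ℝ (y + t • e) e)) / (‖y + t • e‖ ^ 2) ^ 2) • (y + t • e))) t := by
  have h3 : HasDerivAt (fun t : ℝ => y + t • e) e t := by
    simpa using ((hasDerivAt_id t).smul_const e).const_add y
  have hn : HasDerivAt (fun t : ℝ => ‖y + t • e‖ ^ 2) (2 * inner ℝ (y + t • e) e) t := h3.norm_sq
  have hK := hn.rpow_const (p := -((k:ℝ)/2)) (Or.inl h0)
  have hq : HasDerivAt (fun t : ℝ => c / ‖y + t • e‖ ^ 2)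
      (-(c * (2 * inner ℝ (y + t • e) e)) / (‖y + t • e‖ ^ 2) ^ 2) t := by
    simpa using (hasDerivAt_const t c).fun_div hn h0
  have hγ := hq.fun_smul h3
  have hG := ((hg.differentiable (by norm_num))
    ((c / ‖y + t • e‖ ^ 2) • (y + t • e))).hasFDerivAt.comp_hasDerivAt t hγ
  have := hK.fun_mul hG
  simpa only [kelvin, inv_norm_pow_eq_rpow, Function.comp_def] using this

theorem hasDerivAt_deriv_kelvin_line (k : ℕ) (c : ℝ) {g : 𝔼 → ℝ} (hg : ContDiff ℝ 2 g) {y e : 𝔼}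
    (hy : y ≠ 0) (he : ‖e‖ = 1) {n a : ℝ} (hn' : ‖y‖ ^ 2 = n) (ha : inner ℝ y e = a) {q : 𝔼}
    (hq' : q = (c / n) • y) :
    HasDerivAt (fun t : ℝ =>
      ((2 * inner ℝ (y + t • e) e) * (-((k:ℝ)/2)) * (‖y + t • e‖ ^ 2) ^ (-((k:ℝ)/2) - 1)
          * g ((c / ‖y + t • e‖ ^ 2) • (y + t • e))
        + (‖y + t • e‖ ^ 2) ^ (-((k:ℝ)/2)) * fderiv ℝ g ((c / ‖y + t • e‖ ^ 2) • (y + t • e))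
          ((c / ‖y + t • e‖ ^ 2) • e
            + (-(c * (2 * inner ℝ (y + t • e) e)) / (‖y + t • e‖ ^ 2) ^ 2) • (y + t • e))))
      (n ^ (-((k:ℝ)/2)) * ((k * (k + 2) * a ^ 2 / n ^ 2 - k / n) * g q
        + (- 2 * k * a / n) * (c / n * fderiv ℝ g q e - 2 * c * a / n ^ 2 * fderiv ℝ g q y)
        + ((c / n) ^ 2 * fderiv ℝ (fderiv ℝ g) q e e
            - 2 * c ^ 2 * a / n ^ 3 * (fderiv ℝ (fderiv ℝ g) q e y + fderiv ℝ (fderiv ℝ g) q y e)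
            + 4 * c ^ 2 * a ^ 2 / n ^ 4 * fderiv ℝ (fderiv ℝ g) q y y)
        + (-(4 * c * a / n ^ 2) * fderiv ℝ g q e
            + (8 * c * a ^ 2 / n ^ 3 - 2 * c / n ^ 2) * fderiv ℝ g q y))) 0 := by
  have h00 : ‖y + (0:ℝ) • e‖ ^ 2 ≠ 0 := by simpa using hy
  have hn0 : 0 < n := by rw [← hn']; positivity
  have h3 : HasDerivAt (fun t : ℝ => y + t • e) e 0 := by
    simpa using ((hasDerivAt_id (0:ℝ)).smul_const e).const_add y
  have hn : HasDerivAt (fun t : ℝ => ‖y + t • e‖ ^ 2) (2 * inner ℝ (y + (0:ℝ) • e) e) 0 :=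
    h3.norm_sq
  have hb : HasDerivAt (fun t : ℝ => 2 * inner ℝ (y + t • e) e) 2 0 := by
    have := (h3.inner ℝ (hasDerivAt_const (0:ℝ) e)).const_mul 2
    simpa [he] using this
  have hK := hn.rpow_const (p := -((k:ℝ)/2)) (Or.inl h00)
  have hK1 := hn.rpow_const (p := -((k:ℝ)/2) - 1) (Or.inl h00)
  have hq : HasDerivAt (fun t : ℝ => c / ‖y + t • e‖ ^ 2)
      (-(c * (2 * inner ℝ (y + (0:ℝ) • e) e)) / (‖y + (0:ℝ) • e‖ ^ 2) ^ 2) 0 := by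
    simpa using (hasDerivAt_const (0:ℝ) c).fun_div hn h00
  have hγ := hq.fun_smul h3
  have hG := ((hg.differentiable (by norm_num))
    ((c / ‖y + (0:ℝ) • e‖ ^ 2) • (y + (0:ℝ) • e))).hasFDerivAt.comp_hasDerivAt (0:ℝ) hγ
  have hg' : Differentiable ℝ (fderiv ℝ g) :=
    (hg.fderiv_right (m := 1) (by norm_num)).differentiable (by norm_num)
  have hDG :=
    (hg' ((c / ‖y + (0:ℝ) • e‖ ^ 2) • (y + (0:ℝ) • e))).hasFDerivAt.comp_hasDerivAt (0:ℝ) hγ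
  have hq2 := ((hb.const_mul c).fun_neg).fun_div (hn.fun_pow 2) (pow_ne_zero 2 h00)
  have hγ' := (hq.smul_const e).fun_add (hq2.fun_smul h3)
  have hfin := (((hb.mul_const (-((k:ℝ)/2))).fun_mul hK1).fun_mul hG).fun_add
    (hK.fun_mul (hDG.clm_apply hγ'))
  refine hfin.congr_deriv ?_
  have r1 : n ^ (-((k:ℝ)/2) - 1) = n ^ (-((k:ℝ)/2)) / n := Real.rpow_sub_one hn0.ne' _
  have r2 : n ^ (-((k:ℝ)/2) - 1 - 1) = n ^ (-((k:ℝ)/2)) / n / n := by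
    rw [Real.rpow_sub_one hn0.ne', r1]
  simp only [zero_smul, add_zero, hn', ha, ← hq', r1, r2, Function.comp_def, map_add, map_smul,
    add_apply, smul_apply, smul_eq_mul]
  field_simp
  ring

theorem lap_kelvin {k : ℕ} (hk : N = k + 2) (c : ℝ) {g : 𝔼 → ℝ} (hg : ContDiff ℝ 2 g) {y : 𝔼}
    (hy : y ≠ 0) :
    lap (kelvin k c g) y = c ^ 2 / ‖y‖ ^ (k + 4) * lap g ((c / ‖y‖ ^ 2) • y) := by
  set n := ‖y‖ ^ 2 with hn
  set q := (c / n) • y with hq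
  have hn0 : 0 < n := by positivity
  set A := fderiv ℝ g q with hA
  set B := fderiv ℝ (fderiv ℝ g) q with hB
  have hysum : y = ∑ i : Fin N, y i • (EuclideanSpace.single i (1:ℝ) : 𝔼) := by
    have := (EuclideanSpace.basisFun (Fin N) ℝ).sum_repr y
    simpa using this.symm
  have hline : ∀ i : Fin N, fderiv ℝ (fun z => fderiv ℝ (kelvin k c g) z
      (EuclideanSpace.single i 1)) y (EuclideanSpace.single i 1) = _ := fun i =>
    fderiv_fderiv_eq_of_line (contDiffAt_kelvin k c hg hy) _
      (by
        have h2 : Tendsto (fun t : ℝ => ‖y + t • (EuclideanSpace.single i (1:ℝ) : 𝔼)‖ ^ 2) (𝓝 0)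
            (𝓝 (‖y‖ ^ 2)) := by
          have : Continuous
              (fun t : ℝ => ‖y + t • (EuclideanSpace.single i (1:ℝ) : 𝔼)‖ ^ 2) := by fun_prop
          simpa using this.tendsto 0
        filter_upwards [h2.eventually_ne hn0.ne'] with t ht
          using hasDerivAt_kelvin_line k c hg y _ ht)
      (hasDerivAt_deriv_kelvin_line k c hg (a := y i) hy (by simp) hn.symm (by
        simp [EuclideanSpace.inner_single_right]) hq)
  have s1 : ∑ i : Fin N, y i ^ 2 = n := by
    rw [hn, EuclideanSpace.norm_sq_eq]; simp
  have slin : ∀ T : 𝔼 →L[ℝ] ℝ, ∑ i : Fin N, y i * T (EuclideanSpace.single i 1) = T y := by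
    intro T
    conv_rhs => rw [hysum]
    simp
  have s2 := slin A
  have s3 : ∑ i : Fin N, y i * B (EuclideanSpace.single i 1) y = B y y := slin (B.flip y)
  have s4 := slin (B y)
  have s5 : lap g q = ∑ i : Fin N, B (EuclideanSpace.single i 1) (EuclideanSpace.single i 1) :=
    lap_eq_sum_fderiv (y := q) hg.contDiffAt
  have s6 : ∑ i : Fin N, (1:ℝ) = k + 2 := by simp [hk]
  have hK : n ^ (-((k:ℝ)/2)) = (‖y‖ ^ k)⁻¹ := (inv_norm_pow_eq_rpow k y).symm
  have hexp : lap (kelvin k c g) y = n ^ (-((k:ℝ)/2)) * (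
      (k * (k + 2) / n ^ 2 * g q + 4 * k * c / n ^ 3 * A y + 4 * c ^ 2 / n ^ 4 * B y y
        + 8 * c / n ^ 3 * A y) * ∑ i : Fin N, y i ^ 2
      + (- k / n * g q - 2 * c / n ^ 2 * A y) * ∑ i : Fin N, (1:ℝ)
      + (- 2 * k * c / n ^ 2 - 4 * c / n ^ 2) * ∑ i : Fin N, y i * A (EuclideanSpace.single i 1)
      - 2 * c ^ 2 / n ^ 3 * ∑ i : Fin N, y i * B (EuclideanSpace.single i 1) y
      - 2 * c ^ 2 / n ^ 3 * ∑ i : Fin N, y i * B y (EuclideanSpace.single i 1)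
      + (c / n) ^ 2 * ∑ i : Fin N, B (EuclideanSpace.single i 1) (EuclideanSpace.single i 1)) := by
    unfold lap
    simp only [Finset.mul_sum, ← Finset.sum_add_distrib, ← Finset.sum_sub_distrib]
    refine Finset.sum_congr rfl fun i _ => (hline i).trans ?_
    rw [← hA, ← hB]
    field_simp
    ring
  rw [hexp, s1, s2, s3, s4, s6, ← s5, hK, pow_add, show ‖y‖ ^ 4 = n ^ 2 by rw [hn]; ring]
  have hk0 : ‖y‖ ^ k ≠ 0 := by positivity
  field_simp
  ring
end kelvin

section comparison
variable {N : ℕ}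

local notation "𝔼" => EuclideanSpace ℝ (Fin N)

theorem kelvin_one (k : ℕ) (c : ℝ) :
    kelvin k c (fun _ : 𝔼 => 1) = fun z : 𝔼 => (‖z‖ ^ k)⁻¹ := by
  funext z
  simp [kelvin]

theorem contDiffAt_inv_norm_pow (k : ℕ) {y : 𝔼} (hy : y ≠ 0) :
    ContDiffAt ℝ 2 (fun z : 𝔼 => (‖z‖ ^ k)⁻¹) y := by
  rw [← kelvin_one k 0]
  exact contDiffAt_kelvin k 0 contDiff_const hy

theorem lap_inv_norm_pow {k : ℕ} (hk : N = k + 2) {y : 𝔼} (hy : y ≠ 0) :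
    lap (fun z : 𝔼 => (‖z‖ ^ k)⁻¹) y = 0 := by
  rw [← kelvin_one k 0, lap_kelvin hk 0 contDiff_const hy]
  simp

theorem le_of_lap_neg_annulus {k : ℕ} (hk : N = k + 2) {w : 𝔼 → ℝ} {a b : ℝ} (ha : 0 < a)
    (hc : ContinuousOn w {y | a ≤ ‖y‖ ∧ ‖y‖ ≤ b})
    (hw : ∀ y, a < ‖y‖ → ‖y‖ < b → ContDiffAt ℝ 2 w y ∧ lap w y < 0) {β d : ℝ}
    (hbd : ∀ y, ‖y‖ = a ∨ ‖y‖ = b → β * (‖y‖ ^ k)⁻¹ + d ≤ w y) {y : 𝔼} (hya : a ≤ ‖y‖)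
    (hyb : ‖y‖ ≤ b) : β * (‖y‖ ^ k)⁻¹ + d ≤ w y := by
  set A : Set 𝔼 := {y | a ≤ ‖y‖ ∧ ‖y‖ ≤ b} with hA
  have hne : ∀ z : 𝔼, a ≤ ‖z‖ → z ≠ 0 := fun z hz => norm_pos_iff.1 (ha.trans_le hz)
  have hcomp : IsCompact A := by
    refine (isCompact_closedBall (0:𝔼) b).of_isClosed_subset ?_ ?_
    · exact (isClosed_le continuous_const continuous_norm).inter
        (isClosed_le continuous_norm continuous_const)
    · intro z hz
      simpa using hz.2
  have hcf : ContinuousOn (fun z => w z - (β * (‖z‖ ^ k)⁻¹ + d)) A := by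
    refine hc.sub (ContinuousOn.add (ContinuousOn.mul continuousOn_const ?_) continuousOn_const)
    exact fun z hz => (contDiffAt_inv_norm_pow k (hne z hz.1)).continuousAt.continuousWithinAt
  obtain ⟨z, hz, hmin⟩ := hcomp.exists_isMinOn ⟨y, hya, hyb⟩ hcf
  have hzy : w z - (β * (‖z‖ ^ k)⁻¹ + d) ≤ w y - (β * (‖y‖ ^ k)⁻¹ + d) := hmin ⟨hya, hyb⟩
  by_cases hz' : ‖z‖ = a ∨ ‖z‖ = b
  · linarith [hbd z hz']
  push Not at hz'
  have hza : a < ‖z‖ := lt_of_le_of_ne hz.1 (Ne.symm hz'.1)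
  have hzb : ‖z‖ < b := lt_of_le_of_ne hz.2 hz'.2
  have hnhds : A ∈ 𝓝 z := by
    filter_upwards [continuous_norm.continuousAt.eventually (lt_mem_nhds hza),
      continuous_norm.continuousAt.eventually (gt_mem_nhds hzb)] with x h1 h2
      using ⟨h1.le, h2.le⟩
  have hloc := hmin.isLocalMin hnhds
  obtain ⟨h1, h2⟩ := hw z hza hzb
  have h3 := contDiffAt_inv_norm_pow k (hne z hz.1)
  have h4 : ContDiffAt ℝ 2 (fun z : 𝔼 => β * (‖z‖ ^ k)⁻¹ + d) z :=
    (contDiffAt_const.mul h3).add contDiffAt_const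
  have h5 := lap_nonneg_of_isLocalMin (h1.sub h4) hloc
  have h6 := lap_sub h1 h4
  rw [lap_const_mul_add h3, lap_inv_norm_pow hk (hne z hz.1)] at h6
  have h7 : 0 ≤ lap (fun z => w z - (β * (‖z‖ ^ k)⁻¹ + d)) z := h5
  linarith

theorem le_of_lap_neg_exterior {k : ℕ} (hk0 : 1 ≤ k) (hk : N = k + 2) {w : 𝔼 → ℝ} {a m : ℝ}
    (ha : 0 < a) (hm : 0 ≤ m) (hc : ContinuousOn w {y | a ≤ ‖y‖})
    (hw : ∀ y, a < ‖y‖ → ContDiffAt ℝ 2 w y ∧ lap w y < 0)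
    (hpos : ∀ y, a ≤ ‖y‖ → 0 ≤ w y) (hbd : ∀ y, ‖y‖ = a → m ≤ w y) {y : 𝔼} (hya : a ≤ ‖y‖) :
    m * (a / ‖y‖) ^ k ≤ w y := by
  have hy0 : 0 < ‖y‖ := ha.trans_le hya
  have key : ∀ b, ‖y‖ ≤ b → m * a ^ k * (‖y‖ ^ k)⁻¹ + -(m * a ^ k * (b ^ k)⁻¹) ≤ w y := by
    intro b hb
    refine le_of_lap_neg_annulus hk ha (hc.mono fun z hz => hz.1)
      (fun z h1 _ => hw z h1) ?_ hya hb
    have hb0 : 0 < b := hy0.trans_le hb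
    rintro z (hz | hz)
    · have : 0 ≤ m * a ^ k * (b ^ k)⁻¹ := by positivity
      have h2 : m * a ^ k * (‖z‖ ^ k)⁻¹ = m := by rw [hz]; field_simp
      linarith [hbd z hz]
    · rw [hz]
      have := hpos z (by linarith)
      linarith
  have hlim : Tendsto (fun b : ℝ => m * a ^ k * (‖y‖ ^ k)⁻¹ + -(m * a ^ k * (b ^ k)⁻¹)) atTop
      (𝓝 (m * a ^ k * (‖y‖ ^ k)⁻¹ + -(m * a ^ k * 0))) := by
    refine tendsto_const_nhds.add (Tendsto.neg (tendsto_const_nhds.mul ?_))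
    exact (tendsto_pow_atTop (by omega)).inv_tendsto_atTop
  have := le_of_tendsto hlim ((eventually_ge_atTop ‖y‖).mono key)
  rw [div_pow]
  calc _ = m * a ^ k * (‖y‖ ^ k)⁻¹ + -(m * a ^ k * 0) := by ring
    _ ≤ _ := this
end comparison

section movingSpheres
variable {N : ℕ}

local notation "𝔼" => EuclideanSpace ℝ (Fin N)

/-- Along rays inside a region where `k v + 2 Dv(x) x` is nonnegative, reflection decreases. -/
theorem pow_mul_le_of_radial_nonneg {k : ℕ} {v : 𝔼 → ℝ} (hv : Differentiable ℝ v) {y : 𝔼} {s : ℝ}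
    (hs0 : 0 < s) (hs1 : s ≤ 1)
    (hE : ∀ r ∈ Icc s 1, 0 ≤ k * v (r ^ 2 • y) + 2 * fderiv ℝ v (r ^ 2 • y) (r ^ 2 • y)) :
    s ^ k * v (s ^ 2 • y) ≤ v y := by
  have hd : ∀ r : ℝ, HasDerivAt (fun r : ℝ => r ^ k * v (r ^ 2 • y))
      (k * r ^ (k - 1) * v (r ^ 2 • y) + r ^ k * fderiv ℝ v (r ^ 2 • y) ((2 * r) • y)) r := by
    intro r
    have h1 : HasDerivAt (fun r : ℝ => r ^ 2 • y) ((2 * r) • y) r := by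
      simpa using (hasDerivAt_pow 2 r).smul_const y
    exact (hasDerivAt_pow k r).fun_mul ((hv (r ^ 2 • y)).hasFDerivAt.comp_hasDerivAt r h1)
  have hmono : MonotoneOn (fun r : ℝ => r ^ k * v (r ^ 2 • y)) (Icc s 1) := by
    refine monotoneOn_of_deriv_nonneg (convex_Icc s 1)
      (fun r _ => (hd r).continuousAt.continuousWithinAt)
      (fun r _ => (hd r).differentiableAt.differentiableWithinAt) fun r hr => ?_
    rw [interior_Icc] at hr
    have hr0 : 0 < r := hs0.trans hr.1
    rw [(hd r).deriv]
    have h2 := mul_nonneg (pow_nonneg hr0.le k) (hE r ⟨hr.1.le, hr.2.le⟩)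
    rw [map_smul, smul_eq_mul] at h2 ⊢
    have h3 : r ^ k * (k * v (r ^ 2 • y)) = r * (k * r ^ (k - 1) * v (r ^ 2 • y)) := by
      rcases k with _ | k
      · simp
      · rw [pow_succ, Nat.add_sub_cancel]; ring
    refine (mul_nonneg_iff_of_pos_left hr0).1 ?_
    calc _ ≤ _ := h2
      _ = _ := by rw [mul_add, h3]; ring
  have := hmono ⟨le_rfl, hs1⟩ ⟨hs1, le_rfl⟩ hs1
  simpa using this

/-- The values of `v` outside the sphere of radius `μ` dominate those of its reflection. -/
def Dominates (k : ℕ) (v : 𝔼 → ℝ) (μ : ℝ) : Prop :=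
  ∀ s ∈ Ioc (0:ℝ) 1, ∀ θ ∈ Metric.sphere (0:𝔼) 1, s ^ k * v ((s * μ) • θ) ≤ v ((μ / s) • θ)

theorem isClosed_dominates (k : ℕ) {v : 𝔼 → ℝ} (hv : Continuous v) :
    IsClosed {μ | Dominates k v μ} := by
  simp only [Dominates, Set.ofPred_forall]
  refine isClosed_iInter fun s => isClosed_iInter fun _ => isClosed_iInter fun θ =>
    isClosed_iInter fun _ => isClosed_le ?_ ?_
  · exact continuous_const.mul (hv.comp (by fun_prop))
  · exact hv.comp (by fun_prop)

theorem exists_dominates_near_zero {k : ℕ} (hk0 : 1 ≤ k) (hk : N = k + 2) {v : 𝔼 → ℝ}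
    (hv : ContDiff ℝ 2 v) (hpos : ∀ x, 0 < v x) (hlap : ∀ x, lap v x < 0) :
    ∃ μ₀ > 0, ∀ μ ∈ Ioc 0 μ₀, Dominates k v μ := by
  have hcE : Continuous fun x => k * v x + 2 * fderiv ℝ v x x := by
    have h1 := hv.continuous_fderiv (by norm_num)
    have h2 := hv.continuous
    exact (continuous_const.mul h2).add (continuous_const.mul (h1.clm_apply continuous_id))
  have hE0 : 0 < k * v 0 + 2 * fderiv ℝ v 0 0 := by
    have := hpos 0
    simp only [map_zero, mul_zero, add_zero]
    positivity
  obtain ⟨r₁, hr₁, hball⟩ := Metric.eventually_nhds_iff_ball.1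
    (hcE.continuousAt.eventually (lt_mem_nhds hE0))
  set r := r₁ / 2 with hr
  have hr0 : 0 < r := by positivity
  have hN : Nonempty (Fin N) := ⟨⟨0, by omega⟩⟩
  obtain ⟨z₁, -, hz₁⟩ := (isCompact_closedBall (0:𝔼) r).exists_isMinOn
    ⟨0, by simpa using hr0.le⟩ hv.continuous.continuousOn
  obtain ⟨z₂, -, hz₂⟩ := (isCompact_closedBall (0:𝔼) r).exists_isMaxOn
    ⟨0, by simpa using hr0.le⟩ hv.continuous.continuousOn
  set m := v z₁ with hm
  set M := v z₂ with hM
  have hm0 : 0 < m := hpos _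
  have hM0 : 0 < M := hpos _
  have hmM : m ≤ M := by
    have h1 : m ≤ v 0 := hz₁ (by simpa using hr0.le)
    have h2 : v 0 ≤ M := hz₂ (by simpa using hr0.le)
    exact h1.trans h2
  have hq1 : m / M ≤ 1 := (div_le_one hM0).2 hmM
  refine ⟨r * (m / M), by positivity, fun μ hμ s hs θ hθ => ?_⟩
  have hμ0 := hμ.1
  have hs0 := hs.1
  have hθ1 : ‖θ‖ = 1 := by simpa using hθ
  have hsy : s ^ 2 • ((μ / s) • θ) = (s * μ) • θ := by
    rw [smul_smul]; congr 1; field_simp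
  have hny : ‖(μ / s) • θ‖ = μ / s := by
    rw [norm_smul, hθ1, mul_one, Real.norm_of_nonneg (by positivity)]
  rw [← hsy]
  set y := (μ / s) • θ with hy
  rcases le_total ‖y‖ r with hyr | hyr
  · refine pow_mul_le_of_radial_nonneg (hv.differentiable (by norm_num)) hs0 hs.2 fun t ht => ?_
    refine (hball _ ?_).le
    have ht0 : 0 < t := hs0.trans_le ht.1
    rw [mem_ball_zero_iff, norm_smul, Real.norm_of_nonneg (by positivity)]
    have : t ^ 2 ≤ 1 := pow_le_one₀ ht0.le ht.2
    nlinarith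
  · have h1 : m * (r / ‖y‖) ^ k ≤ v y :=
      le_of_lap_neg_exterior hk0 hk hr0 hm0.le hv.continuous.continuousOn
        (fun z _ => ⟨hv.contDiffAt, hlap z⟩) (fun z _ => (hpos z).le)
        (fun z hz => hz₁ (by simp [hz])) hyr
    have hμr : μ ≤ r := hμ.2.trans (mul_le_of_le_one_right hr0.le hq1)
    have h2 : v (s ^ 2 • y) ≤ M := by
      refine hz₂ ?_
      rw [hsy, mem_closedBall_zero_iff, norm_smul, hθ1, mul_one,
        Real.norm_of_nonneg (by positivity)]
      exact (mul_le_of_le_one_left hμ0.le hs.2).trans hμr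
    have h3 : s ^ k * M ≤ m * (r / ‖y‖) ^ k := by
      have hrs : s ≤ (m / M) * (r / ‖y‖) := by
        rw [hny]
        have h4 : m / M * (r / (μ / s)) = (r * (m / M)) * s / μ := by field_simp
        rw [h4, le_div_iff₀ hμ0, mul_comm]
        exact mul_le_mul_of_nonneg_right hμ.2 hs0.le
      have h5 : (m / M) ^ k ≤ m / M := pow_le_of_le_one (by positivity) hq1 (by omega)
      calc s ^ k * M ≤ ((m / M) * (r / ‖y‖)) ^ k * M := by gcongr
        _ = (m / M) ^ k * (r / ‖y‖) ^ k * M := by rw [mul_pow]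
        _ ≤ (m / M) * (r / ‖y‖) ^ k * M := by gcongr
        _ = m * (r / ‖y‖) ^ k := by field_simp
    calc s ^ k * v (s ^ 2 • y) ≤ s ^ k * M := by gcongr
      _ ≤ v y := h3.trans h1

theorem nonneg_of_hasDerivAt_of_le_right {G : ℝ → ℝ} {G' a b : ℝ} (hab : a < b)
    (hG : HasDerivAt G G' a) (hle : ∀ t ∈ Ioc a b, G a ≤ G t) : 0 ≤ G' := by
  have h1 := (hasDerivWithinAt_iff_tendsto_slope' (s := Ioi a) (by simp)).1 hG.hasDerivWithinAt
  refine ge_of_tendsto h1 ?_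
  filter_upwards [Ioc_mem_nhdsGT hab] with t ht
  rw [slope_def_field]
  exact div_nonneg (sub_nonneg.2 (hle t ht)) (sub_nonneg.2 ht.1.le)

theorem Dominates.eventually {k : ℕ} (hk0 : 1 ≤ k) (hk : N = k + 2) {v : 𝔼 → ℝ}
    (hv : ContDiff ℝ 2 v)
    (hH : ∀ x y, ∀ τ : ℝ, 1 < τ → v y ≤ τ ^ k * v x → -lap v y < τ ^ (k + 4) * -lap v x)
    {μ : ℝ} (hμ : 0 < μ) (hD : Dominates k v μ) : ∀ᶠ ν in 𝓝 μ, Dominates k v ν := by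
  have hvc := hv.continuous
  have hvd : Differentiable ℝ v := hv.differentiable (by norm_num)
  set W : 𝔼 → ℝ := fun z => v z - (μ ^ k * kelvin k (μ ^ 2) v z + 0) with hW
  have hWray : ∀ (r : ℝ) (θ : 𝔼), 0 < r → ‖θ‖ = 1 →
      W (r • θ) = v (r • θ) - (μ / r) ^ k * v ((μ ^ 2 / r) • θ) := by
    intro r θ hr hθ
    simp only [hW, kelvin, norm_smul, hθ, mul_one, Real.norm_of_nonneg hr.le, smul_smul]
    rw [show μ ^ 2 / r ^ 2 * r = μ ^ 2 / r by field_simp, div_pow]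
    ring
  have hpolar : ∀ y : 𝔼, 0 < ‖y‖ → ∃ θ : 𝔼, ‖θ‖ = 1 ∧ y = ‖y‖ • θ := by
    intro y hy
    refine ⟨‖y‖⁻¹ • y, ?_, ?_⟩
    · rw [norm_smul, norm_inv, norm_norm, inv_mul_cancel₀ hy.ne']
    · rw [smul_smul, mul_inv_cancel₀ hy.ne', one_smul]
  have hW0 : ∀ y, μ ≤ ‖y‖ → 0 ≤ W y := by
    intro y hy
    have hy0 := hμ.trans_le hy
    obtain ⟨θ, hθ, hyθ⟩ := hpolar y hy0
    have h1 := hD (μ / ‖y‖) ⟨by positivity, (div_le_one hy0).2 hy⟩ θ (by simpa using hθ)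
    rw [hyθ, hWray _ _ hy0 hθ]
    rw [show μ / (μ / ‖y‖) = ‖y‖ by field_simp, show μ / ‖y‖ * μ = μ ^ 2 / ‖y‖ by ring] at h1
    linarith
  have hsmooth : ∀ y : 𝔼, y ≠ 0 → ContDiffAt ℝ 2 W y := fun y hy =>
    hv.contDiffAt.sub ((contDiffAt_const.mul (contDiffAt_kelvin k _ hv hy)).add contDiffAt_const)
  have hWlap : ∀ y, μ < ‖y‖ → ContDiffAt ℝ 2 W y ∧ lap W y < 0 := by
    intro y hy
    have hy0 := hμ.trans hy
    have hne : y ≠ 0 := norm_pos_iff.1 hy0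
    refine ⟨hsmooth y hne, ?_⟩
    have hkel := contDiffAt_kelvin k (μ ^ 2) hv hne
    rw [hW, lap_sub hv.contDiffAt ((contDiffAt_const.mul hkel).add contDiffAt_const),
      lap_const_mul_add hkel, lap_kelvin hk _ hv hne]
    have h1 := hH y ((μ ^ 2 / ‖y‖ ^ 2) • y) (‖y‖ / μ) ((one_lt_div hμ).2 hy) (by
      have := hW0 y hy.le
      simp only [hW, kelvin, add_zero, sub_nonneg] at this
      rw [div_pow, div_mul_eq_mul_div, le_div_iff₀ (by positivity)]
      have h2 := mul_le_mul_of_nonneg_right this (pow_nonneg hy0.le k)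
      calc _ = μ ^ k * ((‖y‖ ^ k)⁻¹ * v ((μ ^ 2 / ‖y‖ ^ 2) • y)) * ‖y‖ ^ k := by field_simp
        _ ≤ _ := h2
        _ = _ := mul_comm _ _)
    rw [div_pow, div_mul_eq_mul_div, lt_div_iff₀ (by positivity)] at h1
    have h3 : μ ^ k * ((μ ^ 2) ^ 2 / ‖y‖ ^ (k + 4) * lap v ((μ ^ 2 / ‖y‖ ^ 2) • y))
        = (lap v ((μ ^ 2 / ‖y‖ ^ 2) • y) * μ ^ (k + 4)) / ‖y‖ ^ (k + 4) := by
      rw [pow_add μ]; ring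
    rw [h3, sub_neg, lt_div_iff₀ (by positivity)]
    linarith
  have hWpos : ∀ y, μ < ‖y‖ → 0 < W y := by
    intro y hy
    refine lt_of_le_of_ne (hW0 y hy.le) fun h0 => ?_
    have hloc : IsLocalMin W y := by
      filter_upwards [continuous_norm.continuousAt.eventually (lt_mem_nhds hy)] with z hz
      rw [← h0]
      exact hW0 z hz.le
    obtain ⟨h1, h2⟩ := hWlap y hy
    linarith [lap_nonneg_of_isLocalMin h1 hloc]
  have hWc : ContinuousOn W {y | μ ≤ ‖y‖} := fun y hy =>
    (hsmooth y (norm_pos_iff.1 (hμ.trans_le hy))).continuousAt.continuousWithinAt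
  have hN : Nonempty (Fin N) := ⟨⟨0, by omega⟩⟩
  obtain ⟨z, hz, hmin⟩ := (isCompact_sphere (0:𝔼) (2 * μ)).exists_isMinOn
    (NormedSpace.sphere_nonempty.2 (by positivity))
    (hWc.mono fun y hy => by
      have : ‖y‖ = 2 * μ := by simpa using hy
      show μ ≤ ‖y‖
      linarith)
  set m := W z with hm
  have hm0 : 0 < m := hWpos z (by
    have : ‖z‖ = 2 * μ := by simpa using hz
    linarith)
  have hmS : ∀ y, ‖y‖ = 2 * μ → m ≤ W y := fun y hy => hmin (by simpa using hy)
  have hext : ∀ y, 2 * μ ≤ ‖y‖ → m * (2 * μ / ‖y‖) ^ k ≤ W y := fun y hy =>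
    le_of_lap_neg_exterior hk0 hk (by positivity) hm0.le
      (hWc.mono fun x (hx : 2 * μ ≤ ‖x‖) => show μ ≤ ‖x‖ by linarith)
      (fun x hx => hWlap x (by linarith)) (fun x hx => hW0 x (by linarith)) hmS hy
  have hann : ∀ y, μ ≤ ‖y‖ → ‖y‖ ≤ 2 * μ → -(m * μ ^ k) * (‖y‖ ^ k)⁻¹ + m ≤ W y :=
    fun y h1 h2 => le_of_lap_neg_annulus hk hμ (hWc.mono fun x hx => hx.1)
      (fun x hx _ => hWlap x hx) (by
        rintro x (hx | hx)
        · have := hW0 x hx.ge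
          rw [hx]
          have h3 : -(m * μ ^ k) * (μ ^ k)⁻¹ + m = 0 := by field_simp; ring
          linarith
        · have h3 : 0 ≤ m * μ ^ k * (‖x‖ ^ k)⁻¹ := by positivity
          linarith [hmS x hx]) h1 h2
  have hE : ∀ θ : 𝔼, ‖θ‖ = 1 → 0 < k * v (μ • θ) + 2 * fderiv ℝ v (μ • θ) (μ • θ) := by
    intro θ hθ
    set y := μ • θ with hy
    have hd : ∀ t : ℝ, t ≠ 0 →
        HasDerivAt (fun t : ℝ => (t ^ k)⁻¹) (-(k * t ^ (k - 1)) / (t ^ k) ^ 2) t :=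
      fun t ht => (hasDerivAt_pow k t).fun_inv (pow_ne_zero _ ht)
    have hG : HasDerivAt (fun t : ℝ => v (t • y) - (t ^ k)⁻¹ * v (t⁻¹ • y) - m * (1 - (t ^ k)⁻¹))
        (k * v y + 2 * fderiv ℝ v y y - m * k) 1 := by
      have h1 : HasDerivAt (fun t : ℝ => t • y) y 1 := by
        simpa using (hasDerivAt_id (1:ℝ)).smul_const y
      have h2 : HasDerivAt (fun t : ℝ => t⁻¹ • y) (-y) 1 := by
        simpa using (hasDerivAt_inv (one_ne_zero (α := ℝ))).smul_const y
      have h3 := (hvd ((1:ℝ) • y)).hasFDerivAt.comp_hasDerivAt (1:ℝ) h1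
      have h4 := (hvd ((1:ℝ)⁻¹ • y)).hasFDerivAt.comp_hasDerivAt (1:ℝ) h2
      have h5 := hd 1 one_ne_zero
      have h6 := (h3.fun_sub (h5.fun_mul h4)).fun_sub ((h5.const_sub 1).const_mul m)
      refine h6.congr_deriv ?_
      simp
      ring
    have := nonneg_of_hasDerivAt_of_le_right one_lt_two hG (by
      intro t ht
      have ht0 : 0 < t := one_pos.trans ht.1
      have hty : t • y = (t * μ) • θ := by rw [hy, smul_smul]
      have hnorm : ‖t • y‖ = t * μ := by
        rw [hty, norm_smul, hθ, mul_one, Real.norm_of_nonneg (by positivity)]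
      have h1 := hann (t • y) (by rw [hnorm]; nlinarith [ht.1]) (by rw [hnorm]; nlinarith [ht.2])
      rw [hnorm, hty, hWray _ _ (by positivity) hθ] at h1
      rw [hty, hy, smul_smul]
      rw [show μ / (t * μ) = t⁻¹ by field_simp, show μ ^ 2 / (t * μ) = t⁻¹ * μ by field_simp,
        inv_pow, mul_pow,
        show -(m * μ ^ k) * (t ^ k * μ ^ k)⁻¹ + m = m * (1 - (t ^ k)⁻¹) by field_simp; ring] at h1
      simp
      rw [smul_smul]
      linarith)
    have hmk : 0 < m * k := by
      have : (0:ℝ) < k := by exact_mod_cast hk0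
      positivity
    linarith
  have hcE : Continuous fun x => k * v x + 2 * fderiv ℝ v x x := by
    have h1 := hv.continuous_fderiv (by norm_num)
    exact (continuous_const.mul hvc).add (continuous_const.mul (h1.clm_apply continuous_id))
  have htube : ∀ᶠ ν in 𝓝 μ, ∀ q ∈ Icc (0:ℝ) 1 ×ˢ Metric.sphere (0:𝔼) 1, 0 < q.1 → q.1 ≤ 1 →
      ‖q.2‖ = 1 → q.1 ^ k * v ((q.1 * ν) • q.2) ≤ v ((ν / q.1) • q.2) := by
    refine (isCompact_Icc.prod (isCompact_sphere (0:𝔼) 1)).eventually_forall_of_forall_eventually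
      (P := fun ν q => 0 < q.1 → q.1 ≤ 1 →
        ‖q.2‖ = 1 → q.1 ^ k * v ((q.1 * ν) • q.2) ≤ v ((ν / q.1) • q.2)) ?_
    rintro ⟨s, θ⟩ ⟨hs, hθ⟩
    have hθ1 : ‖θ‖ = 1 := by simpa using hθ
    have hs0 : (0:ℝ) ≤ s := hs.1
    have hs1 : s ≤ 1 := hs.2
    have hcν : ContinuousAt (fun q : ℝ × ℝ × 𝔼 => q.1) (μ, s, θ) := continuousAt_fst
    have hcs : ContinuousAt (fun q : ℝ × ℝ × 𝔼 => q.2.1) (μ, s, θ) := by fun_prop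
    have hcθ : ContinuousAt (fun q : ℝ × ℝ × 𝔼 => q.2.2) (μ, s, θ) := by fun_prop
    have hνpos := hcν.eventually (lt_mem_nhds (half_lt_self hμ))
    rcases hs0.eq_or_lt with h0 | h0
    · subst h0
      have hc1 : ContinuousAt (fun q : ℝ × ℝ × 𝔼 =>
          μ ^ k * v ((μ ^ 2 * q.2.1 / q.1) • q.2.2) + m * (2 * μ) ^ k
            - q.1 ^ k * v ((q.2.1 * q.1) • q.2.2)) (μ, 0, θ) := by
        refine ContinuousAt.sub (ContinuousAt.add (continuousAt_const.mul ?_) continuousAt_const)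
          ((hcν.pow k).mul ?_)
        · exact hvc.continuousAt.comp
            (((continuousAt_const.mul hcs).div hcν hμ.ne').smul hcθ)
        · exact hvc.continuousAt.comp ((hcs.mul hcν).smul hcθ)
      have hc2 := hc1.eventually (lt_mem_nhds (a := 0) (by
        simp
        positivity))
      have hc3 := hcs.eventually (gt_mem_nhds (show (0:ℝ) < 1 / 4 by norm_num))
      filter_upwards [hνpos, hc2, hc3] with ⟨ν, t, ω⟩ a1 a2 a3 b1 b2 b3
      simp only at a1 a2 a3 b1 b2 b3 ⊢
      have hν0 : 0 < ν := by linarith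
      have hr : 0 < ν / t := by positivity
      have hnorm : ‖(ν / t) • ω‖ = ν / t := by
        rw [norm_smul, b3, mul_one, Real.norm_of_nonneg hr.le]
      have h1 := hext ((ν / t) • ω) (by
        rw [hnorm, le_div_iff₀ b1]; nlinarith)
      rw [hnorm, hWray _ _ hr b3, show μ ^ 2 / (ν / t) = μ ^ 2 * t / ν by field_simp,
        show μ / (ν / t) = μ * (t / ν) by field_simp,
        show 2 * μ / (ν / t) = (2 * μ) * (t / ν) by field_simp, mul_pow, mul_pow _ (t / ν)] at h1
      have h2 : t ^ k * v ((t * ν) • ω) = (t / ν) ^ k * (ν ^ k * v ((t * ν) • ω)) := by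
        rw [div_pow]; field_simp
      have h3 : (t / ν) ^ k * (ν ^ k * v ((t * ν) • ω)) ≤ (t / ν) ^ k *
          (μ ^ k * v ((μ ^ 2 * t / ν) • ω) + m * (2 * μ) ^ k) := by
        gcongr
        linarith
      rw [h2]
      refine h3.trans ?_
      linarith
    · rcases hs1.eq_or_lt with h1 | h1
      · subst h1
        obtain ⟨r, hr, hball⟩ := Metric.eventually_nhds_iff_ball.1
          (hcE.continuousAt.eventually (lt_mem_nhds (hE θ hθ1)))
        have e1 : ContinuousAt (fun q : ℝ × ℝ × 𝔼 => (q.2.1 * q.1) • q.2.2) (μ, 1, θ) :=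
          (hcs.mul hcν).smul hcθ
        have e2 : ContinuousAt (fun q : ℝ × ℝ × 𝔼 => (q.1 / q.2.1) • q.2.2) (μ, 1, θ) :=
          (hcν.div hcs one_ne_zero).smul hcθ
        have e3 := e1.eventually (Metric.ball_mem_nhds _ hr)
        have e4 := e2.eventually (Metric.ball_mem_nhds _ hr)
        simp only [one_mul, div_one] at e3 e4
        filter_upwards [hνpos, e3, e4] with ⟨ν, t, ω⟩ a1 a2 a3 b1 b2 b3
        simp only at a1 a2 a3 b1 b2 b3 ⊢
        have hν0 : 0 < ν := by linarith
        have hty : t ^ 2 • ((ν / t) • ω) = (t * ν) • ω := by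
          rw [smul_smul]; congr 1; field_simp
        rw [← hty] at a2 ⊢
        refine pow_mul_le_of_radial_nonneg hvd b1 b2 fun x hx => (hball _ ?_).le
        have hx0 : 0 < x := b1.trans_le hx.1
        have hseg : x ^ 2 • ((ν / t) • ω) ∈ segment ℝ (t ^ 2 • ((ν / t) • ω)) ((ν / t) • ω) := by
          rcases b2.eq_or_lt with h2 | h2
          · have : x = 1 := le_antisymm hx.2 (h2 ▸ hx.1)
            simp [h2, this]
          · have ht2 : 0 < 1 - t ^ 2 := by nlinarith
            refine ⟨(1 - x ^ 2) / (1 - t ^ 2), (x ^ 2 - t ^ 2) / (1 - t ^ 2), ?_, ?_, ?_, ?_⟩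
            · exact div_nonneg (by nlinarith [hx.2]) ht2.le
            · exact div_nonneg (by nlinarith [hx.1]) ht2.le
            · field_simp; ring
            · rw [smul_smul, ← add_smul]; congr 1; field_simp; ring
        exact (convex_ball _ r).segment_subset a2 a3 hseg
      · have hstrict : s ^ k * v ((s * μ) • θ) < v ((μ / s) • θ) := by
          have hr : 0 < μ / s := by positivity
          have h2 := hWpos ((μ / s) • θ) (by
            rw [norm_smul, hθ1, mul_one, Real.norm_of_nonneg hr.le, lt_div_iff₀ h0]
            nlinarith)
          rw [hWray _ _ hr hθ1, show μ ^ 2 / (μ / s) = s * μ by field_simp,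
            show μ / (μ / s) = s by field_simp] at h2
          linarith
        have e1 : ContinuousAt (fun q : ℝ × ℝ × 𝔼 => q.2.1 ^ k * v ((q.2.1 * q.1) • q.2.2))
            (μ, s, θ) :=
          (hcs.pow k).mul (hvc.continuousAt.comp ((hcs.mul hcν).smul hcθ))
        have e2 : ContinuousAt (fun q : ℝ × ℝ × 𝔼 => v ((q.1 / q.2.1) • q.2.2)) (μ, s, θ) :=
          hvc.continuousAt.comp ((hcν.div hcs h0.ne').smul hcθ)
        filter_upwards [e1.eventually_lt e2 hstrict] with q hq _ _ _ using hq.le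
  filter_upwards [htube] with ν hν s hs θ hθ
  exact hν (s, θ) ⟨⟨hs.1.le, hs.2⟩, hθ⟩ hs.1 hs.2 (by simpa using hθ)

theorem dominates_of_pos {k : ℕ} (hk0 : 1 ≤ k) (hk : N = k + 2) {v : 𝔼 → ℝ}
    (hv : ContDiff ℝ 2 v) (hpos : ∀ x, 0 < v x) (hlap : ∀ x, lap v x < 0)
    (hH : ∀ x y, ∀ τ : ℝ, 1 < τ → v y ≤ τ ^ k * v x → -lap v y < τ ^ (k + 4) * -lap v x)
    {μ : ℝ} (hμ : 0 < μ) : Dominates k v μ := by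
  obtain ⟨μ₀, hμ₀, hsmall⟩ := exists_dominates_near_zero hk0 hk hv hpos hlap
  rcases le_total μ μ₀ with hle | hle
  · exact hsmall μ ⟨hμ, hle⟩
  · refine IsClosed.Icc_subset_of_forall_exists_gt (a := μ₀) (b := μ) (s := {ν | Dominates k v ν})
      ((isClosed_dominates k hv.continuous).inter isClosed_Icc) (hsmall μ₀ ⟨hμ₀, le_rfl⟩) ?_
      ⟨hle, le_rfl⟩
    rintro ν ⟨hν, hν'⟩ b hb
    have h1 := Dominates.eventually hk0 hk hv hH (hμ₀.trans_le hν'.1) hν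
    have h2 : ∀ᶠ x in 𝓝[>] ν, Dominates k v x := h1.filter_mono nhdsWithin_le_nhds
    obtain ⟨x, hx1, hx2⟩ := (h2.and (Ioc_mem_nhdsGT hb)).exists
    exact ⟨x, hx1, hx2⟩

theorem radial_nonneg_of_dominates {k : ℕ} {v : 𝔼 → ℝ} (hv : Differentiable ℝ v)
    (hD : ∀ μ > 0, Dominates k v μ) {y : 𝔼} (hy : y ≠ 0) :
    0 ≤ k * v y + 2 * fderiv ℝ v y y := by
  have hG : HasDerivAt (fun t : ℝ => t ^ k * v (t ^ 2 • y)) (k * v y + 2 * fderiv ℝ v y y) 1 := by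
    have h1 : HasDerivAt (fun t : ℝ => t ^ 2 • y) ((2 * 1 : ℝ) • y) 1 := by
      simpa using (hasDerivAt_pow 2 (1:ℝ)).smul_const y
    refine ((hasDerivAt_pow k (1:ℝ)).fun_mul
      ((hv ((1:ℝ) ^ 2 • y)).hasFDerivAt.comp_hasDerivAt (1:ℝ) h1)).congr_deriv ?_
    simp
  refine nonneg_of_hasDerivAt_of_le_right one_lt_two hG fun t ht => ?_
  have ht0 : 0 < t := one_pos.trans ht.1
  have hy0 : 0 < ‖y‖ := norm_pos_iff.2 hy
  have := hD (t * ‖y‖) (by positivity) t⁻¹ ⟨by positivity, inv_le_one_of_one_le₀ ht.1.le⟩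
    (‖y‖⁻¹ • y) (by simp [norm_smul, hy0.ne'])
  rw [smul_smul, smul_smul, show t⁻¹ * (t * ‖y‖) * ‖y‖⁻¹ = 1 by field_simp,
    show t * ‖y‖ / t⁻¹ * ‖y‖⁻¹ = t ^ 2 by field_simp, one_smul, inv_pow,
    inv_mul_le_iff₀ (by positivity)] at this
  simpa using this

/-- A Liouville theorem: no positive superharmonic function has a Laplacian satisfying the
comparison inequality which drives the method of moving spheres. -/
theorem false_of_lap_comparison {k : ℕ} (hk0 : 1 ≤ k) (hk : N = k + 2) {v : 𝔼 → ℝ}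
    (hv : ContDiff ℝ 2 v) (hpos : ∀ x, 0 < v x) (hlap : ∀ x, lap v x < 0)
    (hH : ∀ x y, ∀ τ : ℝ, 1 < τ → v y ≤ τ ^ k * v x → -lap v y < τ ^ (k + 4) * -lap v x) :
    False := by
  have key : ∀ x y : 𝔼, 0 ≤ k * v x + 2 * fderiv ℝ v x y := by
    intro x y
    rcases eq_or_ne y 0 with rfl | hy
    · have := (hpos x).le
      simp only [map_zero, mul_zero, add_zero]
      positivity
    set a := x - y with ha
    have hva : ContDiff ℝ 2 fun z => v (a + z) := hv.comp (contDiff_const.add contDiff_id)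
    have h1 := radial_nonneg_of_dominates (hva.differentiable (by norm_num)) (fun μ hμ =>
      dominates_of_pos hk0 hk hva (fun z => hpos _)
        (fun z => by rw [lap_comp_const_add]; exact hlap _)
        (fun z z' τ h1 h2 => by
          rw [lap_comp_const_add, lap_comp_const_add]; exact hH _ _ τ h1 h2) hμ) hy
    rw [fderiv_comp_add_left, show a + y = x by simp [ha]] at h1
    exact h1
  have hzero : ∀ x, fderiv ℝ v x = 0 := by
    intro x
    ext y
    set A := fderiv ℝ v x y with hA
    rw [zero_apply]
    by_contra hne
    have h1 := key x ((-(k * v x + 1) / A) • y)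
    rw [map_smul, smul_eq_mul, ← hA, div_mul_cancel₀ _ hne] at h1
    have : (0:ℝ) ≤ k * v x := by have := (hpos x).le; positivity
    linarith
  have h2 := hlap 0
  simp [lap, hzero] at h2

end movingSpheres

section changeOfVariables

variable {h : ℝ → ℝ} {α σ : ℝ}

theorem psi'_pos (s : ℝ) : 0 < psi' h α s := Real.exp_pos _

theorem hasDerivAt_psi' (hα : 0 < α) (hh : ContinuousOn h (Ioi 0)) {s : ℝ} (hs : 0 < s) :
    HasDerivAt (psi' h α) (-(h s * psi' h α s)) s := by
  have h1 : HasDerivAt (fun s => ∫ r in α..s, h r) (h s) s := by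
    refine intervalIntegral.integral_hasDerivAt_right ?_
      (hh.stronglyMeasurableAtFilter isOpen_Ioi s hs) (hh.continuousAt (Ioi_mem_nhds hs))
    refine (hh.mono fun x hx => ?_).intervalIntegrable
    exact (lt_min hα hs).trans_le hx.1
  refine h1.fun_neg.exp.congr_deriv ?_
  simp only [psi']
  ring

theorem continuousOn_psi' (hα : 0 < α) (hh : ContinuousOn h (Ioi 0)) :
    ContinuousOn (psi' h α) (Ioi 0) :=
  fun _ hs => (hasDerivAt_psi' hα hh hs).continuousAt.continuousWithinAt

theorem monotoneOn_rpow_mul_psi' (hα : 0 < α) (hh : ContinuousOn h (Ioi 0))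
    (hbd : ∀ s, 0 < s → s * h s ≤ σ) :
    MonotoneOn (fun s => s ^ σ * psi' h α s) (Ioi 0) := by
  have hd : ∀ s : ℝ, 0 < s → HasDerivAt (fun s => s ^ σ * psi' h α s)
      (σ * s ^ (σ - 1) * psi' h α s + s ^ σ * -(h s * psi' h α s)) s := fun s hs =>
    (Real.hasDerivAt_rpow_const (Or.inl hs.ne')).fun_mul (hasDerivAt_psi' hα hh hs)
  refine monotoneOn_of_deriv_nonneg (convex_Ioi 0)
    (fun s hs => (hd s hs).continuousAt.continuousWithinAt)
    (fun s hs => ?_) fun s hs => ?_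
  · rw [interior_Ioi] at hs
    exact (hd s hs).differentiableAt.differentiableWithinAt
  · rw [interior_Ioi] at hs
    have hs0 : 0 < s := hs
    rw [(hd s hs0).deriv, Real.rpow_sub_one hs0.ne']
    have h1 : 0 ≤ s ^ σ / s * psi' h α s * (σ - s * h s) := by
      have := hbd s hs0
      have h2 := (psi'_pos (h := h) (α := α) s).le
      have : 0 ≤ σ - s * h s := by linarith
      positivity
    refine h1.trans_eq ?_
    field_simp
    ring

theorem intervalIntegrable_psi' (hσ : σ < 1) (hα : 0 < α) (hh : ContinuousOn h (Ioi 0))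
    (hbd : ∀ s, 0 < s → s * h s ≤ σ) {s : ℝ} (hs : 0 < s) :
    IntervalIntegrable (psi' h α) volume 0 s := by
  have h1 : IntervalIntegrable (fun t : ℝ => s ^ σ * psi' h α s * t ^ (-σ)) volume 0 s :=
    (intervalIntegral.intervalIntegrable_rpow' (by linarith)).const_mul _
  refine h1.mono_fun ?_ ?_
  · rw [uIoc_of_le hs.le]
    exact ((continuousOn_psi' hα hh).mono fun x hx => hx.1).aestronglyMeasurable measurableSet_Ioc
  · rw [uIoc_of_le hs.le]
    refine (ae_restrict_iff' measurableSet_Ioc).2 (Eventually.of_forall fun t ht => ?_)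
    have ht0 : 0 < t := ht.1
    have h2 : t ^ σ * psi' h α t ≤ s ^ σ * psi' h α s :=
      monotoneOn_rpow_mul_psi' hα hh hbd ht0 hs ht.2
    have h3 := psi'_pos (h := h) (α := α) s
    have h4 := psi'_pos (h := h) (α := α) t
    beta_reduce
    rw [Real.norm_of_nonneg h4.le, Real.norm_of_nonneg (by positivity), Real.rpow_neg ht0.le,
      ← div_eq_mul_inv, le_div_iff₀ (by positivity)]
    linarith

theorem hasDerivAt_psi (hσ : σ < 1) (hα : 0 < α) (hh : ContinuousOn h (Ioi 0))
    (hbd : ∀ s, 0 < s → s * h s ≤ σ) {s : ℝ} (hs : 0 < s) :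
    HasDerivAt (psi h α) (psi' h α s) s :=
  intervalIntegral.integral_hasDerivAt_right (intervalIntegrable_psi' hσ hα hh hbd hs)
    ((continuousOn_psi' hα hh).stronglyMeasurableAtFilter isOpen_Ioi s hs)
    (hasDerivAt_psi' hα hh hs).continuousAt

theorem psi_pos (hσ : σ < 1) (hα : 0 < α) (hh : ContinuousOn h (Ioi 0))
    (hbd : ∀ s, 0 < s → s * h s ≤ σ) {s : ℝ} (hs : 0 < s) : 0 < psi h α s :=
  intervalIntegral.intervalIntegral_pos_of_pos_on (intervalIntegrable_psi' hσ hα hh hbd hs)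
    (fun t _ => psi'_pos t) hs

theorem contDiffOn_psi (hσ : σ < 1) (hα : 0 < α) (hh : ContinuousOn h (Ioi 0))
    (hbd : ∀ s, 0 < s → s * h s ≤ σ) : ContDiffOn ℝ 2 (psi h α) (Ioi 0) := by
  have h1 : ContDiffOn ℝ 1 (psi' h α) (Ioi 0) := by
    rw [show (1 : WithTop ℕ∞) = 0 + 1 by simp, contDiffOn_succ_iff_deriv_of_isOpen isOpen_Ioi]
    refine ⟨fun s hs => (hasDerivAt_psi' hα hh hs).differentiableAt.differentiableWithinAt,
      by simp, contDiffOn_zero.2 ?_⟩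
    exact (hh.mul (continuousOn_psi' hα hh)).neg.congr fun s hs => (hasDerivAt_psi' hα hh hs).deriv
  rw [show (2 : WithTop ℕ∞) = 1 + 1 by norm_num, contDiffOn_succ_iff_deriv_of_isOpen isOpen_Ioi]
  exact ⟨fun s hs => (hasDerivAt_psi hσ hα hh hbd hs).differentiableAt.differentiableWithinAt,
    by simp, h1.congr fun s hs => (hasDerivAt_psi hσ hα hh hbd hs).deriv⟩

theorem contDiff_psi_comp {E : Type*} [NormedAddCommGroup E] [NormedSpace ℝ E] (hσ : σ < 1)
    (hα : 0 < α) (hh : ContinuousOn h (Ioi 0)) (hbd : ∀ s, 0 < s → s * h s ≤ σ) {u : E → ℝ}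
    (hu : ContDiff ℝ 2 u) (hpos : ∀ x, 0 < u x) : ContDiff ℝ 2 fun x => psi h α (u x) :=
  (contDiffOn_psi hσ hα hh hbd).comp_contDiff hu hpos

theorem norm_gradient_sq {N : ℕ} (u : EuclideanSpace ℝ (Fin N) → ℝ)
    (x : EuclideanSpace ℝ (Fin N)) :
    ‖gradient u x‖ ^ 2 = ∑ i : Fin N, fderiv ℝ u x (EuclideanSpace.single i 1) ^ 2 := by
  rw [EuclideanSpace.norm_sq_eq]
  refine Finset.sum_congr rfl fun i _ => ?_
  rw [Real.norm_eq_abs, sq_abs]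
  congr 1
  have : inner ℝ (gradient u x) (EuclideanSpace.single i 1)
      = fderiv ℝ u x (EuclideanSpace.single i 1) := by
    rw [gradient, InnerProductSpace.toDual_symm_apply]
  rw [← this, EuclideanSpace.inner_single_right]
  simp

theorem lap_psi_comp {N : ℕ} (hσ : σ < 1)
    (hα : 0 < α) (hh : ContinuousOn h (Ioi 0)) (hbd : ∀ s, 0 < s → s * h s ≤ σ)
    {u : EuclideanSpace ℝ (Fin N) → ℝ}
    (hu : ContDiff ℝ 2 u) (hpos : ∀ x, 0 < u x) (x : EuclideanSpace ℝ (Fin N)) :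
    lap (fun x => psi h α (u x)) x
      = psi' h α (u x) * (lap u x - h (u x) * ‖gradient u x‖ ^ 2) := by
  rw [norm_gradient_sq]
  unfold lap
  rw [Finset.mul_sum, ← Finset.sum_sub_distrib, Finset.mul_sum]
  refine Finset.sum_congr rfl fun i _ => ?_
  set e : EuclideanSpace ℝ (Fin N) := EuclideanSpace.single i 1
  have h0 := (eventually_hasDerivAt_line hu.contDiffAt (y := x) e)
  have h1 : HasDerivAt (fun t : ℝ => u (x + t • e)) (fderiv ℝ u x e) 0 := by
    simpa using h0.self_of_nhds
  have h2 : HasDerivAt (psi' h α) (-(h (u x) * psi' h α (u x))) (u (x + (0:ℝ) • e)) := by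
    simpa using hasDerivAt_psi' hα hh (hpos x)
  have h3 := (h2.comp (0:ℝ) h1).fun_mul (hasDerivAt_fderiv_line hu.contDiffAt (y := x) e)
  refine fderiv_fderiv_eq_of_line (contDiff_psi_comp hσ hα hh hbd hu hpos).contDiffAt e
    (d := fun t : ℝ => psi' h α (u (x + t • e)) * fderiv ℝ u (x + t • e) e) ?_ ?_
  · filter_upwards [h0] with t ht
    exact (hasDerivAt_psi hσ hα hh hbd (hpos _)).comp t ht
  · refine h3.congr_deriv ?_
    simp only [zero_smul, add_zero, Function.comp_def]
    ring

end changeOfVariables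

theorem liouville_whole_space
    {N : ℕ} (hN : 3 ≤ N) {p σ α : ℝ} (hp : 1 < p) (hσ : σ ∈ Set.Ioo (0:ℝ) 1) (hα : 0 < α)
    (h : ℝ → ℝ) (hh_cont : ContinuousOn h (Set.Ioi 0))
    (hh_nonneg : ∀ s : ℝ, 0 < s → 0 ≤ h s) (hh_bd : ∀ s : ℝ, 0 < s → s * h s ≤ σ)
    (hdec : StrictAntiOn (fun s => psi' h α s * s ^ p / psi h α s ^ (twoStar N - 1))
      (Set.Ioi 0)) :
    ¬ ∃ u : EuclideanSpace ℝ (Fin N) → ℝ,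
      ContDiff ℝ 2 u ∧ (∀ x, 0 < u x) ∧
      (∀ x, -lap u x + h (u x) * ‖gradient u x‖ ^ 2 = u x ^ p) := by
  rintro ⟨u, hu, hpos, heq⟩
  obtain ⟨k, rfl⟩ : ∃ k, N = k + 2 := ⟨N - 2, by omega⟩
  have hk0 : 1 ≤ k := by omega
  have hkR : (0:ℝ) < k := by exact_mod_cast hk0
  have hlap : ∀ x, -lap (fun x => psi h α (u x)) x = psi' h α (u x) * u x ^ p := by
    intro x
    rw [lap_psi_comp hσ.2 hα hh_cont hh_bd hu hpos x, ← heq x]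
    ring
  have hFpos : ∀ s : ℝ, 0 < s → 0 < psi' h α s * s ^ p := fun s hs =>
    mul_pos (psi'_pos s) (Real.rpow_pos_of_pos hs p)
  have hψpos : ∀ s : ℝ, 0 < s → 0 < psi h α s := fun s hs => psi_pos hσ.2 hα hh_cont hh_bd hs
  have hmono : ∀ s t : ℝ, 0 < s → s ≤ t → psi' h α s * s ^ p ≤ psi' h α t * t ^ p := by
    intro s t hs hst
    have ht := hs.trans_le hst
    have h1 : s ^ σ * psi' h α s ≤ t ^ σ * psi' h α t :=
      monotoneOn_rpow_mul_psi' hα hh_cont hh_bd hs ht hst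
    have h2 : s ^ (p - σ) ≤ t ^ (p - σ) :=
      Real.rpow_le_rpow hs.le hst (by linarith [hσ.2])
    have h3 := psi'_pos (h := h) (α := α) t
    have hsplit : ∀ r : ℝ, 0 < r → psi' h α r * r ^ p = r ^ σ * psi' h α r * r ^ (p - σ) := by
      intro r hr
      rw [mul_right_comm, ← Real.rpow_add hr]
      ring_nf
    rw [hsplit s hs, hsplit t ht]
    gcongr
  have hexp : twoStar (k + 2) - 1 = (k + 4) / k := by
    unfold twoStar
    push_cast
    rw [add_sub_cancel_right]
    field_simp
    ring
  rw [hexp] at hdec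
  refine false_of_lap_comparison hk0 rfl (contDiff_psi_comp hσ.2 hα hh_cont hh_bd hu hpos)
    (fun x => hψpos _ (hpos x)) (fun x => ?_) fun x y τ hτ hle => ?_
  · have := hlap x
    linarith [hFpos _ (hpos x)]
  · rw [hlap, hlap]
    have hτ1 : 1 < τ ^ (k + 4) := one_lt_pow₀ hτ (by omega)
    have hFx := hFpos _ (hpos x)
    rcases le_or_gt (u y) (u x) with hyx | hyx
    · have := hmono _ _ (hpos y) hyx
      nlinarith
    · have h1 := hdec (hpos x) (hpos y) hyx
      have hx := hψpos _ (hpos x)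
      have hy := hψpos _ (hpos y)
      have hτ0 : 0 < τ := one_pos.trans hτ
      simp only at h1
      rw [div_lt_div_iff₀ (Real.rpow_pos_of_pos hy _) (Real.rpow_pos_of_pos hx _)] at h1
      have h2 : psi h α (u y) ^ (((k:ℝ) + 4) / k)
          ≤ τ ^ (k + 4) * psi h α (u x) ^ (((k:ℝ) + 4) / k) := by
        refine (Real.rpow_le_rpow hy.le hle (by positivity)).trans_eq ?_
        rw [Real.mul_rpow (by positivity) hx.le, ← Real.rpow_natCast τ k, ← Real.rpow_mul hτ0.le,
          mul_div_cancel₀ _ hkR.ne', ← Real.rpow_natCast τ (k + 4)]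
        push_cast
        rfl
      have h3 := mul_le_mul_of_nonneg_left h2 hFx.le
      have hx' := Real.rpow_pos_of_pos hx (((k:ℝ) + 4) / k)
      refine lt_of_mul_lt_mul_right (h1.trans_le ?_) hx'.le
      linarith
end
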